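/- arXiv:1611.08827 — 8 statements merged into one kernel-verified Lean document; each statement's English description precedes it below -/
import Mathlib

section
/- Let Ω ⊆ ℍ be a symmetric slice domain and let f₁, f₂ : Ω → ℍ be slice regular functions with no common zeros, i.e. for every q ∈ Ω either f₁(q) ≠ 0 or f₂(q) ≠ 0. Fix I, J ∈ 𝕊 with IJ = −JI and holomorphic functions F_ℓ, G_ℓ : Ω_I → L_I with f_ℓ(z) = F_ℓ(z) + G_ℓ(z)J for all z ∈ Ω_I (ℓ = 1, 2). Then for every z₀ ∈ Ω_I there exist an open set U ⊆ Ω_I with z₀ ∈ U, invariant under the conjugation z ↦ z̄, and holomorphic functions H₁, K₁, H₂, K₂ : U → L_I such that on U: F₁H₁ − G₁K̂₁ + F₂H₂ − G₂K̂₂ = 1 and F₁K₁ + G₁Ĥ₁ + F₂K₂ + G₂Ĥ₂ = 0. -/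
noncomputable section

/-- The 2-sphere of quaternionic imaginary units. -/
def QSphere : Set (Quaternion ℝ) := {q | q ^ 2 = -1}

/-- The complex plane `L_I = ℝ + ℝI` through an imaginary unit `I`. -/
def sliceL (I : Quaternion ℝ) : Set (Quaternion ℝ) :=
  {q | ∃ x y : ℝ, q = (x : Quaternion ℝ) + (y : Quaternion ℝ) * I}

/-- The planar parametrization of the restriction of `f` to the slice `L_I`. -/
def sliceMap (f : Quaternion ℝ → Quaternion ℝ) (I : Quaternion ℝ) : ℝ × ℝ → Quaternion ℝ :=
  fun p => f ((p.1 : Quaternion ℝ) + (p.2 : Quaternion ℝ) * I)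

/-- `f` is holomorphic (has continuous partial derivatives and satisfies
`(∂/∂x + I ∂/∂y) f = 0`) at the points of `U` lying in the slice `L_I`. -/
def HoloSlice (f : Quaternion ℝ → Quaternion ℝ) (I : Quaternion ℝ)
    (U : Set (Quaternion ℝ)) : Prop :=
  ∀ x y : ℝ, (x : Quaternion ℝ) + (y : Quaternion ℝ) * I ∈ U →
    ContDiffAt ℝ 1 (sliceMap f I) (x, y) ∧
    fderiv ℝ (sliceMap f I) (x, y) (1, 0) + I * fderiv ℝ (sliceMap f I) (x, y) (0, 1) = 0

/-- `f` is slice regular on `Ω`. -/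
def SliceRegularOn (f : Quaternion ℝ → Quaternion ℝ) (Ω : Set (Quaternion ℝ)) : Prop :=
  ∀ I ∈ QSphere, HoloSlice f I Ω

/-- `Ω` is a symmetric slice domain. -/
def IsSymmSliceDomain (Ω : Set (Quaternion ℝ)) : Prop :=
  IsOpen Ω ∧ IsConnected Ω ∧ (∃ x : ℝ, (x : Quaternion ℝ) ∈ Ω) ∧
  (∀ I ∈ QSphere, IsConnected (Ω ∩ sliceL I)) ∧
  (∀ x y : ℝ, ∀ I ∈ QSphere, (x : Quaternion ℝ) + (y : Quaternion ℝ) * I ∈ Ω →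
    ∀ J ∈ QSphere, (x : Quaternion ℝ) + (y : Quaternion ℝ) * J ∈ Ω)


/-- The identification of `ℂ` with the slice `L_I = ℝ + ℝI`: `x + yi ↦ x + yI`. -/
def toSlice (I : Quaternion ℝ) (w : ℂ) : Quaternion ℝ :=
  (w.re : Quaternion ℝ) + (w.im : Quaternion ℝ) * I

/-- The hat operation `Ĥ(z) = conj (H (z̄))`. -/
def hatC (H : ℂ → ℂ) (w : ℂ) : ℂ := starRingEnd ℂ (H (starRingEnd ℂ w))


namespace QSphere

theorem mul_self {K : Quaternion ℝ} (hK : K ∈ QSphere) : K * K = -1 := by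
  rw [← sq]; exact hK

theorem neg_mem {K : Quaternion ℝ} (hK : K ∈ QSphere) : -K ∈ QSphere := by
  simpa [QSphere] using hK

theorem normSq_eq_one {K : Quaternion ℝ} (hK : K ∈ QSphere) : Quaternion.normSq K = 1 := by
  have h : Quaternion.normSq K * Quaternion.normSq K = 1 := by
    rw [← map_mul, mul_self hK, Quaternion.normSq_neg, map_one]
  nlinarith [Quaternion.normSq_nonneg (a := K)]

theorem re_eq_zero {K : Quaternion ℝ} (hK : K ∈ QSphere) : K.re = 0 := by
  rw [← Quaternion.sq_eq_neg_normSq, normSq_eq_one hK]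
  simpa [QSphere] using hK

end QSphere

theorem continuous_toSlice (K : Quaternion ℝ) : Continuous (toSlice K) := by
  unfold toSlice
  have h : Continuous fun x : ℝ => (x : Quaternion ℝ) := Quaternion.continuous_coe
  exact (h.comp Complex.continuous_re).add ((h.comp Complex.continuous_im).mul continuous_const)

theorem toSlice_conj (K : Quaternion ℝ) (w : ℂ) :
    toSlice K (starRingEnd ℂ w) = toSlice (-K) w := by
  simp [toSlice]

theorem toSlice_ofReal (K : Quaternion ℝ) (x : ℝ) : toSlice K (x : ℂ) = x := by
  simp [toSlice]

/-- The real-linear functional `q ↦ Re (q u) - i Re (K q u)`, which intertwines left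
multiplication by an imaginary unit `K` with multiplication by `i`. -/
def sliceFunctional (K u : Quaternion ℝ) : Quaternion ℝ →L[ℝ] ℂ :=
  LinearMap.toContinuousLinearMap
    { toFun := fun q => ⟨(q * u).re, -(K * q * u).re⟩
      map_add' := fun a b => by
        apply Complex.ext <;> simp [mul_add, add_mul]; ring
      map_smul' := fun c a => by
        apply Complex.ext <;> simp; ring }

theorem sliceFunctional_apply (K u q : Quaternion ℝ) :
    sliceFunctional K u q = ⟨(q * u).re, -(K * q * u).re⟩ := rfl

theorem sliceFunctional_mul_left {K : Quaternion ℝ} (hK : K ∈ QSphere) (u q : Quaternion ℝ) :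
    sliceFunctional K u (K * q) = Complex.I * sliceFunctional K u q := by
  rw [sliceFunctional_apply, sliceFunctional_apply, ← mul_assoc K K, QSphere.mul_self hK]
  apply Complex.ext <;> simp

theorem differentiableAt_sliceFunctional {f : Quaternion ℝ → Quaternion ℝ}
    {Ω : Set (Quaternion ℝ)} {K L : Quaternion ℝ} (hK : K ∈ QSphere) (hL : L ∈ QSphere)
    (hf : HoloSlice f L Ω) (u : Quaternion ℝ) {w : ℂ} (hw : toSlice L w ∈ Ω) :
    DifferentiableAt ℂ (fun w => sliceFunctional K u ((1 - K * L) * f (toSlice L w))) w := by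
  obtain ⟨hdiff, hCR⟩ := hf w.re w.im hw
  set A := fderiv ℝ (sliceMap f L) (w.re, w.im)
  have hA : HasFDerivAt (sliceMap f L) A (Complex.equivRealProdCLM w) :=
    (hdiff.differentiableAt one_ne_zero).hasFDerivAt
  have hcomp := hA.comp w Complex.equivRealProdCLM.hasFDerivAt
  have hmul := ((ContinuousLinearMap.mul ℝ (Quaternion ℝ)) (1 - K * L)).hasFDerivAt.comp w hcomp
  have hfun := (sliceFunctional K u).hasFDerivAt.comp w hmul
  refine differentiableAt_complex_iff_differentiableAt_real.2 ⟨hfun.differentiableAt, ?_⟩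
  have hd : fderiv ℝ (fun w => sliceFunctional K u ((1 - K * L) * f (toSlice L w))) w = _ :=
    hfun.fderiv
  rw [hd]
  have hI : A (0, 1) = L * A (1, 0) := by
    rw [eq_neg_of_add_eq_zero_left hCR, mul_neg, ← mul_assoc, QSphere.mul_self hL]
    simp
  have hcomm : (1 - K * L) * L = K * (1 - K * L) := by
    rw [sub_mul, mul_sub, mul_assoc K L L, ← mul_assoc K K L, QSphere.mul_self hK,
      QSphere.mul_self hL]
    simp [add_comm]
  simp only [ContinuousLinearMap.comp_apply, ContinuousLinearEquiv.coe_coe,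
    Complex.equivRealProdCLM_apply, Complex.I_re, Complex.I_im, Complex.one_re, Complex.one_im,
    ContinuousLinearMap.mul_apply', smul_eq_mul]
  rw [hI, ← sliceFunctional_mul_left hK, ← mul_assoc, hcomm, mul_assoc]

theorem IsSymmSliceDomain.isOpen_preimage {Ω : Set (Quaternion ℝ)} (hΩ : IsSymmSliceDomain Ω)
    (K : Quaternion ℝ) : IsOpen (toSlice K ⁻¹' Ω) :=
  hΩ.1.preimage (continuous_toSlice K)

theorem IsSymmSliceDomain.toSlice_mem {Ω : Set (Quaternion ℝ)} (hΩ : IsSymmSliceDomain Ω)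
    {K L : Quaternion ℝ} (hK : K ∈ QSphere) (hL : L ∈ QSphere) {w : ℂ}
    (hw : toSlice K w ∈ Ω) : toSlice L w ∈ Ω :=
  hΩ.2.2.2.2 w.re w.im K hK hw L hL

theorem IsSymmSliceDomain.isPreconnected_preimage {Ω : Set (Quaternion ℝ)}
    (hΩ : IsSymmSliceDomain Ω) {K : Quaternion ℝ} (hK : K ∈ QSphere) :
    IsPreconnected (toSlice K ⁻¹' Ω) := by
  have hinv : ∀ w : ℂ, (⟨(toSlice K w).re, -(toSlice K w * K).re⟩ : ℂ) = w := by
    intro w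
    have hre := QSphere.re_eq_zero hK
    rw [toSlice, add_mul, mul_assoc, QSphere.mul_self hK]
    apply Complex.ext <;> simp [hre]
  have hcont : Continuous fun q : Quaternion ℝ => (⟨q.re, -(q * K).re⟩ : ℂ) := by
    refine Complex.equivRealProdCLM.symm.continuous.comp (Continuous.prodMk ?_ ?_)
    · exact Quaternion.continuous_re
    · exact (Quaternion.continuous_re.comp (continuous_id.mul continuous_const)).neg
  convert (hΩ.2.2.2.1 K hK).isPreconnected.image _ hcont.continuousOn
  ext w
  constructor
  · intro hw
    exact ⟨toSlice K w, ⟨hw, w.re, w.im, rfl⟩, hinv w⟩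
  · rintro ⟨q, ⟨hq, x, y, rfl⟩, rfl⟩
    exact Set.mem_of_eq_of_mem (hinv ⟨x, y⟩) hq

/-- The representation formula: the values of a slice regular function on a sphere `x + y𝕊`
are determined by those at `x + yI` and `x - yI`. -/
theorem SliceRegularOn.representation {f : Quaternion ℝ → Quaternion ℝ}
    {Ω : Set (Quaternion ℝ)} (hΩ : IsSymmSliceDomain Ω) (hf : SliceRegularOn f Ω)
    {I K : Quaternion ℝ} (hI : I ∈ QSphere) (hK : K ∈ QSphere) {w : ℂ}
    (hw : toSlice I w ∈ Ω) :
    2 * f (toSlice K w) =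
      (1 - K * I) * f (toSlice I w) + (1 + K * I) * f (toSlice I (starRingEnd ℂ w)) := by
  have hI' := QSphere.neg_mem hI
  let g : ℂ → Quaternion ℝ := fun z => (1 - K * K) * f (toSlice K z) -
    (1 - K * I) * f (toSlice I z) - (1 - K * -I) * f (toSlice (-I) z)
  have hzero : ∀ u, Set.EqOn (fun z => sliceFunctional K u (g z)) 0 (toSlice I ⁻¹' Ω) := by
    intro u
    obtain ⟨x, hx⟩ := hΩ.2.2.1
    have hxmem : (x : ℂ) ∈ toSlice I ⁻¹' Ω := by simpa [toSlice_ofReal] using hx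
    have hdiff : DifferentiableOn ℂ (fun z => sliceFunctional K u (g z)) (toSlice I ⁻¹' Ω) := by
      intro z hz
      simp only [g, map_sub]
      refine DifferentiableAt.differentiableWithinAt (((?_ : DifferentiableAt ℂ _ z).sub ?_).sub ?_)
      · exact differentiableAt_sliceFunctional hK hK (hf K hK) u (hΩ.toSlice_mem hI hK hz)
      · exact differentiableAt_sliceFunctional hK hI (hf I hI) u hz
      · exact differentiableAt_sliceFunctional hK hI' (hf _ hI') u (hΩ.toSlice_mem hI hI' hz)
    have hana := hdiff.analyticOnNhd (hΩ.isOpen_preimage I)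
    refine hana.eqOn_zero_of_preconnected_of_frequently_eq_zero
      (hΩ.isPreconnected_preimage hI) hxmem ?_
    have hreal : ∀ t : ℝ, sliceFunctional K u (g t) = 0 := by
      intro t
      have : g t = 0 := by
        simp only [g, toSlice_ofReal, QSphere.mul_self hK]
        noncomm_ring
      rw [this, map_zero]
    have htend : Filter.Tendsto (fun t : ℝ => (t : ℂ)) (nhdsWithin x {x}ᶜ)
        (nhdsWithin (x : ℂ) {(x : ℂ)}ᶜ) := by
      refine Complex.continuous_ofReal.continuousAt.continuousWithinAt.tendsto_nhdsWithin ?_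
      intro t ht
      simpa using ht
    exact htend.frequently (Filter.Frequently.of_forall hreal)
  have hg : g w = 0 := by
    have h := congrArg Complex.re (hzero (star (g w)) hw)
    simp only [sliceFunctional_apply, Pi.zero_apply, Complex.zero_re] at h
    rw [Quaternion.self_mul_star, Quaternion.re_coe] at h
    exact Quaternion.normSq_eq_zero.1 h
  have h := sub_eq_zero.1 ((sub_sub _ _ _).symm.trans hg)
  rw [QSphere.mul_self hK, sub_neg_eq_add, one_add_one_eq_two] at h
  rw [h, toSlice_conj, mul_neg, sub_neg_eq_add]

theorem toSlice_mul {I : Quaternion ℝ} (hI : I ∈ QSphere) (a b : ℂ) :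
    toSlice I (a * b) = toSlice I a * toSlice I b := by
  have h := QSphere.mul_self hI
  simp only [toSlice, Complex.mul_re, Complex.mul_im, Quaternion.coe_sub, Quaternion.coe_add,
    Quaternion.coe_mul]
  have hc : I * (b.re : Quaternion ℝ) = b.re * I := (Quaternion.coe_commutes _ _).symm
  have hc' : I * (b.im : Quaternion ℝ) = b.im * I := (Quaternion.coe_commutes _ _).symm
  have e : (a.im : Quaternion ℝ) * I * (b.im * I) = -(a.im * b.im) := by
    rw [mul_assoc, ← mul_assoc I, hc', mul_assoc _ I I, h]; simp
  have e' : (a.im : Quaternion ℝ) * I * b.re = a.im * b.re * I := by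
    rw [mul_assoc, hc, mul_assoc]
  simp only [add_mul, mul_add, e, e']
  noncomm_ring

theorem mul_toSlice_of_anticomm {I J : Quaternion ℝ} (hIJ : I * J = -(J * I)) (a : ℂ) :
    J * toSlice I a = toSlice I (starRingEnd ℂ a) * J := by
  have hJI : J * I = -(I * J) := by rw [hIJ, neg_neg]
  simp only [toSlice, mul_add, add_mul, Complex.conj_re, Complex.conj_im, Quaternion.coe_neg]
  rw [← Quaternion.coe_commutes, ← mul_assoc, ← Quaternion.coe_commutes, mul_assoc, hJI]
  noncomm_ring

/-- If `q` anticommutes with `I` and squares to a nonpositive real, then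
`(1 + q) (1 - q)⁻¹ I⁻¹` is an imaginary unit. -/
theorem QSphere.exists_mul_eq_zero_of_anticomm {I q : Quaternion ℝ} (hI : I ∈ QSphere)
    (hqI : q * I = -(I * q)) {r : ℝ} (hr : 0 ≤ r) (hq : q * q = -(r : Quaternion ℝ)) :
    ∃ K ∈ QSphere, (1 - K * I) + (1 + K * I) * q = 0 := by
  have hI2 := QSphere.mul_self hI
  have hr' : (1 + r) ≠ 0 := by positivity
  have hq' : q * q = (-r) • (1 : Quaternion ℝ) := by
    rw [hq, ← Quaternion.coe_mul_eq_smul]; simp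
  set S : Quaternion ℝ := (1 - r) • 1 + (2 : ℝ) • q with hS
  have hIS : I * S = ((1 - r) • 1 - (2 : ℝ) • q) * I := by
    simp only [hS, mul_add, sub_mul, mul_smul_comm, smul_mul_assoc, mul_one, one_mul, hqI]
    module
  have hSS : S * ((1 - r) • 1 - (2 : ℝ) • q) = ((1 + r) * (1 + r)) • (1 : Quaternion ℝ) := by
    simp only [hS, add_mul, mul_sub, mul_smul_comm, smul_mul_assoc, mul_one, one_mul, hq']
    module
  have hKI : -((1 + r)⁻¹ • (S * I)) * I = (1 + r)⁻¹ • S := by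
    rw [neg_mul, smul_mul_assoc, mul_assoc, hI2]
    simp
  refine ⟨-((1 + r)⁻¹ • (S * I)), ?_, ?_⟩
  · have : S * I * (S * I) = -(((1 + r) * (1 + r)) • (1 : Quaternion ℝ)) := by
      rw [mul_assoc, ← mul_assoc I, hIS, mul_assoc, hI2, ← hSS]
      noncomm_ring
    change (_ : Quaternion ℝ) ^ 2 = -1
    rw [sq, neg_mul_neg, smul_mul_smul_comm, this, smul_neg, smul_smul]
    field_simp
    simp
  · have h1 : (1 : Quaternion ℝ) = (1 + r)⁻¹ • ((1 + r) • 1) := by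
      rw [smul_smul, inv_mul_cancel₀ hr', one_smul]
    have h2 : (1 - (1 + r)⁻¹ • S) + (1 + (1 + r)⁻¹ • S) * q
        = (1 + r)⁻¹ • (((1 + r) • 1 - S) + ((1 + r) • 1 + S) * q) := by
      rw [smul_add (1 + r)⁻¹ (_ - S), smul_sub, ← h1, ← smul_mul_assoc, smul_add _ _ S, ← h1]
    rw [hKI, h2]
    simp only [hS, add_mul, smul_mul_assoc, one_mul, hq']
    module

theorem split_conj_eq_mul {I J : Quaternion ℝ} (hI : I ∈ QSphere) (hJ : J ∈ QSphere)
    (hIJ : I * J = -(J * I)) {a b a' b' c : ℂ} (hb : starRingEnd ℂ b' = c * a)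
    (ha : starRingEnd ℂ a' = -(c * b)) :
    toSlice I a' + toSlice I b' * J =
      toSlice I (starRingEnd ℂ c) * J * (toSlice I a + toSlice I b * J) := by
  have hb' : b' = starRingEnd ℂ c * starRingEnd ℂ a := by
    rw [← map_mul, ← hb, Complex.conj_conj]
  have ha' : a' = -(starRingEnd ℂ c * starRingEnd ℂ b) := by
    rw [← map_mul, ← map_neg, ← ha, Complex.conj_conj]
  have hneg : ∀ z : ℂ, toSlice I (-z) = -toSlice I z := by
    intro z
    simp [toSlice]
    abel
  rw [hb', ha', hneg, toSlice_mul hI, toSlice_mul hI, mul_assoc (toSlice I _) J, mul_add J,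
    ← mul_assoc J, mul_toSlice_of_anticomm hIJ a, mul_toSlice_of_anticomm hIJ b, mul_assoc _ J J,
    QSphere.mul_self hJ]
  noncomm_ring

/-- If the hatted values of the splittings of a family of slice regular functions at `w` are
the same multiple of the values themselves, the functions have a common zero. -/
theorem exists_common_zero {ι : Type*} {Ω : Set (Quaternion ℝ)} (hΩ : IsSymmSliceDomain Ω)
    {f : ι → Quaternion ℝ → Quaternion ℝ} (hf : ∀ i, SliceRegularOn (f i) Ω)
    {I J : Quaternion ℝ} (hI : I ∈ QSphere) (hJ : J ∈ QSphere) (hIJ : I * J = -(J * I))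
    {F G : ι → ℂ → ℂ}
    (hsplit : ∀ i w, toSlice I w ∈ Ω →
      f i (toSlice I w) = toSlice I (F i w) + toSlice I (G i w) * J)
    {w c : ℂ} (hw : toSlice I w ∈ Ω) (hG : ∀ i, hatC (G i) w = c * F i w)
    (hF : ∀ i, hatC (F i) w = -(c * G i w)) : ∃ q ∈ Ω, ∀ i, f i q = 0 := by
  have hw' : toSlice I (starRingEnd ℂ w) ∈ Ω := by
    rw [toSlice_conj]
    exact hΩ.toSlice_mem hI (QSphere.neg_mem hI) hw
  set q := toSlice I (starRingEnd ℂ c) * J with hq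
  have hIcomm : I * toSlice I (starRingEnd ℂ c) = toSlice I (starRingEnd ℂ c) * I := by
    simp only [toSlice, mul_add, add_mul]
    rw [← Quaternion.coe_commutes, ← mul_assoc I, ← Quaternion.coe_commutes]
  have hqI : q * I = -(I * q) := by
    rw [hq, ← mul_assoc, hIcomm, mul_assoc, mul_assoc, hIJ, mul_neg, neg_neg]
  have hqq : q * q = -((Complex.normSq c : ℝ) : Quaternion ℝ) := by
    rw [hq, mul_assoc, ← mul_assoc J, mul_toSlice_of_anticomm hIJ, Complex.conj_conj, mul_assoc,
      QSphere.mul_self hJ, ← mul_assoc,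
      ← toSlice_mul hI, ← Complex.normSq_eq_conj_mul_self, toSlice_ofReal, mul_neg_one]
  obtain ⟨K, hK, hKq⟩ :=
    QSphere.exists_mul_eq_zero_of_anticomm hI hqI (Complex.normSq_nonneg c) hqq
  refine ⟨toSlice K w, hΩ.toSlice_mem hI hK hw, fun i => ?_⟩
  have hrep := (hf i).representation hΩ hI hK hw
  have hconj : f i (toSlice I (starRingEnd ℂ w)) = q * f i (toSlice I w) := by
    rw [hsplit i _ hw, hsplit i _ hw']
    exact split_conj_eq_mul hI hJ hIJ (hG i) (hF i)
  rw [hconj, ← mul_assoc, ← add_mul, hKq, zero_mul, two_mul, ← two_smul ℝ] at hrep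
  exact (smul_eq_zero.1 hrep).resolve_left two_ne_zero

theorem DifferentiableOn.hatC {H : ℂ → ℂ} {U : Set ℂ} (hU : IsOpen U)
    (hconj : ∀ w ∈ U, starRingEnd ℂ w ∈ U) (hH : DifferentiableOn ℂ H U) :
    DifferentiableOn ℂ (hatC H) U := fun w hw => by
  have h := ((hH.differentiableAt (hU.mem_nhds (hconj w hw))).conj_conj)
  rw [Complex.conj_conj] at h
  exact h.differentiableWithinAt

/-- `X` is a holomorphic solution on `V` of the pair of linear equations with coefficient rows
`p`, `q` and right-hand side `(1, 0)`. -/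
def IsHoloSolution {ι : Type*} [Fintype ι] (p q X : ι → ℂ → ℂ) (V : Set ℂ) : Prop :=
  (∀ i, DifferentiableOn ℂ (X i) V) ∧
    ∀ w ∈ V, ∑ i, p i w * X i w = 1 ∧ ∑ i, q i w * X i w = 0

theorem IsHoloSolution.mono {ι : Type*} [Fintype ι] {p q X : ι → ℂ → ℂ} {V W : Set ℂ}
    (h : IsHoloSolution p q X V) (hWV : W ⊆ V) : IsHoloSolution p q X W :=
  ⟨fun i => (h.1 i).mono hWV, fun w hw => h.2 w (hWV hw)⟩

theorem IsHoloSolution.congr {ι : Type*} [Fintype ι] {p q X Y : ι → ℂ → ℂ} {V : Set ℂ}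
    (h : IsHoloSolution p q X V) (hY : ∀ i, ∀ w ∈ V, Y i w = X i w) :
    IsHoloSolution p q Y V := by
  refine ⟨fun i => (h.1 i).congr (hY i), fun w hw => ?_⟩
  simp only [hY _ w hw]
  exact h.2 w hw

theorem IsHoloSolution.union {ι : Type*} [Fintype ι] {p q X : ι → ℂ → ℂ} {V W : Set ℂ}
    (hV : IsOpen V) (hW : IsOpen W) (h : IsHoloSolution p q X V)
    (h' : IsHoloSolution p q X W) : IsHoloSolution p q X (V ∪ W) :=
  ⟨fun i => (h.1 i).union_of_isOpen (h'.1 i) hV hW, fun w hw => hw.elim (h.2 w) (h'.2 w)⟩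

/-- Cramer's rule near a point where some `2 × 2` minor does not vanish. -/
theorem exists_isHoloSolution_of_minor_ne_zero {ι : Type*} [Fintype ι] {p q : ι → ℂ → ℂ}
    {D : Set ℂ} (hD : IsOpen D) (hp : ∀ i, DifferentiableOn ℂ (p i) D)
    (hq : ∀ i, DifferentiableOn ℂ (q i) D) {w₀ : ℂ} (hw₀ : w₀ ∈ D) {i j : ι}
    (hm : p i w₀ * q j w₀ - p j w₀ * q i w₀ ≠ 0) :
    ∃ V ⊆ D, IsOpen V ∧ w₀ ∈ V ∧ ∃ X, IsHoloSolution p q X V := by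
  classical
  have hij : i ≠ j := by
    rintro rfl
    exact hm (sub_self _)
  let m : ℂ → ℂ := fun w => p i w * q j w - p j w * q i w
  have hmd : DifferentiableOn ℂ m D := ((hp i).mul (hq j)).sub ((hp j).mul (hq i))
  let X : ι → ℂ → ℂ := fun k w =>
    (if k = i then q j w / m w else 0) + if k = j then -(q i w / m w) else 0
  refine ⟨D ∩ m ⁻¹' {0}ᶜ, Set.inter_subset_left,
    hmd.continuousOn.isOpen_inter_preimage hD isOpen_compl_singleton, ⟨hw₀, hm⟩, X, ?_, ?_⟩
  · intro k
    have hdiv : ∀ l, DifferentiableOn ℂ (fun w => q l w / m w) (D ∩ m ⁻¹' {0}ᶜ) := fun l =>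
      ((hq l).mono Set.inter_subset_left).fun_div (hmd.mono Set.inter_subset_left) fun w hw => hw.2
    refine DifferentiableOn.fun_add ?_ ?_
    · split_ifs
      exacts [hdiv j, differentiableOn_const 0]
    · split_ifs
      exacts [(hdiv i).fun_neg, differentiableOn_const 0]
  · rintro w ⟨-, hw⟩
    have hw : m w ≠ 0 := hw
    simp only [X, mul_add, Finset.sum_add_distrib, mul_ite, mul_zero, Finset.sum_ite_eq',
      Finset.mem_univ, if_true]
    constructor <;> field_simp
    · simp only [m]
      ring
    · ring

/-- Local solutions near `w₀` and near its conjugate glue to a solution on a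
conjugation-invariant neighbourhood. -/
theorem exists_isHoloSolution_conj_invariant {ι : Type*} [Fintype ι] {p q : ι → ℂ → ℂ}
    {D : Set ℂ} (hconj : ∀ w ∈ D, starRingEnd ℂ w ∈ D)
    (hloc : ∀ w ∈ D, ∃ V ⊆ D, IsOpen V ∧ w ∈ V ∧ ∃ X, IsHoloSolution p q X V)
    {w₀ : ℂ} (hw₀ : w₀ ∈ D) :
    ∃ U ⊆ D, IsOpen U ∧ w₀ ∈ U ∧ (∀ w ∈ U, starRingEnd ℂ w ∈ U) ∧
      ∃ X, IsHoloSolution p q X U := by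
  classical
  have hcont : Continuous (starRingEnd ℂ) := Complex.continuous_conj
  obtain ⟨V, hVD, hV, hwV, X, hX⟩ := hloc w₀ hw₀
  by_cases him : w₀.im = 0
  · refine ⟨V ∩ starRingEnd ℂ ⁻¹' V, Set.inter_subset_left.trans hVD, hV.inter (hV.preimage hcont),
      ⟨hwV, ?_⟩, ?_, X, hX.mono Set.inter_subset_left⟩
    · rwa [Set.mem_preimage, Complex.conj_eq_iff_im.2 him]
    · rintro w ⟨hw, hw'⟩
      exact ⟨hw', by rwa [Set.mem_preimage, Complex.conj_conj]⟩
  · obtain ⟨W, hWD, hW, hwW, Y, hY⟩ := hloc _ (hconj w₀ hw₀)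
    let S : Set ℂ := {w | 0 < w.im * w₀.im}
    have hS : IsOpen S :=
      isOpen_lt continuous_const (Complex.continuous_im.mul continuous_const)
    let A : Set ℂ := V ∩ starRingEnd ℂ ⁻¹' W ∩ S
    have hA : IsOpen A := (hV.inter (hW.preimage hcont)).inter hS
    have hB : IsOpen (starRingEnd ℂ ⁻¹' A) := hA.preimage hcont
    have hBW : starRingEnd ℂ ⁻¹' A ⊆ W := fun w hw => by
      simpa using hw.1.2
    have hBS : ∀ w ∈ starRingEnd ℂ ⁻¹' A, w ∉ S := fun w hw hwS => by
      have h1 : 0 < (starRingEnd ℂ w).im * w₀.im := hw.2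
      have h2 : 0 < w.im * w₀.im := hwS
      rw [Complex.conj_im] at h1
      linarith
    have hAV : A ⊆ V := fun w hw => hw.1.1
    refine ⟨A ∪ starRingEnd ℂ ⁻¹' A, Set.union_subset (hAV.trans hVD) (hBW.trans hWD),
      hA.union hB, Or.inl ⟨⟨hwV, hwW⟩, mul_self_pos.2 him⟩, ?_,
      fun i w => if w ∈ S then X i w else Y i w, ?_⟩
    · rintro w (hw | hw)
      · exact Or.inr (by rwa [Set.mem_preimage, Complex.conj_conj])
      · exact Or.inl hw
    · refine IsHoloSolution.union hA hB ?_ ?_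
      · exact (hX.mono hAV).congr fun i w hw => if_pos hw.2
      · exact (hY.mono hBW).congr fun i w hw => if_neg (hBS w hw)

/-- Local solvability on a slice, `n = 2`: if `f₁, f₂` are slice regular on a symmetric
slice domain `Ω` without common zeros and `f_ℓ = F_ℓ + G_ℓ J` is a splitting on `Ω_I`
(identified with a subset of `ℂ` via `toSlice I`), then near any point of `Ω_I` there
is a conjugation-invariant open set `U` and holomorphic `H₁, K₁, H₂, K₂` on `U` with
`F₁H₁ − G₁K̂₁ + F₂H₂ − G₂K̂₂ = 1` and `F₁K₁ + G₁Ĥ₁ + F₂K₂ + G₂Ĥ₂ = 0` on `U`. -/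
theorem local_splitting_solution_on_slice_two_functions
    (Ω : Set (Quaternion ℝ)) (hΩ : IsSymmSliceDomain Ω)
    (f₁ f₂ : Quaternion ℝ → Quaternion ℝ)
    (hreg₁ : SliceRegularOn f₁ Ω) (hreg₂ : SliceRegularOn f₂ Ω)
    (hnz : ∀ q ∈ Ω, f₁ q ≠ 0 ∨ f₂ q ≠ 0)
    (I J : Quaternion ℝ) (hI : I ∈ QSphere) (hJ : J ∈ QSphere)
    (hIJ : I * J = -(J * I))
    (F₁ G₁ F₂ G₂ : ℂ → ℂ)
    (hF₁ : DifferentiableOn ℂ F₁ {w : ℂ | toSlice I w ∈ Ω})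
    (hG₁ : DifferentiableOn ℂ G₁ {w : ℂ | toSlice I w ∈ Ω})
    (hF₂ : DifferentiableOn ℂ F₂ {w : ℂ | toSlice I w ∈ Ω})
    (hG₂ : DifferentiableOn ℂ G₂ {w : ℂ | toSlice I w ∈ Ω})
    (hsplit₁ : ∀ w : ℂ, toSlice I w ∈ Ω →
      f₁ (toSlice I w) = toSlice I (F₁ w) + toSlice I (G₁ w) * J)
    (hsplit₂ : ∀ w : ℂ, toSlice I w ∈ Ω →
      f₂ (toSlice I w) = toSlice I (F₂ w) + toSlice I (G₂ w) * J) :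
    ∀ w₀ : ℂ, toSlice I w₀ ∈ Ω →
      ∃ U : Set ℂ, IsOpen U ∧ w₀ ∈ U ∧ U ⊆ {w : ℂ | toSlice I w ∈ Ω} ∧
        (∀ w ∈ U, starRingEnd ℂ w ∈ U) ∧
        ∃ H₁ K₁ H₂ K₂ : ℂ → ℂ,
          DifferentiableOn ℂ H₁ U ∧ DifferentiableOn ℂ K₁ U ∧
          DifferentiableOn ℂ H₂ U ∧ DifferentiableOn ℂ K₂ U ∧
          ∀ w ∈ U,
            F₁ w * H₁ w - G₁ w * hatC K₁ w + F₂ w * H₂ w - G₂ w * hatC K₂ w = 1 ∧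
            F₁ w * K₁ w + G₁ w * hatC H₁ w + F₂ w * K₂ w + G₂ w * hatC H₂ w = 0 := by
  intro w₀ hw₀
  let D : Set ℂ := {w : ℂ | toSlice I w ∈ Ω}
  have hD : IsOpen D := hΩ.isOpen_preimage I
  have hconj : ∀ w ∈ D, starRingEnd ℂ w ∈ D := fun w hw => by
    change toSlice I _ ∈ Ω
    rw [toSlice_conj]
    exact hΩ.toSlice_mem hI (QSphere.neg_mem hI) hw
  let p : Fin 4 → ℂ → ℂ := ![F₁, -G₁, F₂, -G₂]
  let q : Fin 4 → ℂ → ℂ := ![hatC G₁, hatC F₁, hatC G₂, hatC F₂]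
  have hp : ∀ i, DifferentiableOn ℂ (p i) D := by
    simp only [Fin.forall_fin_succ, IsEmpty.forall_iff, and_true]
    exact ⟨hF₁, hG₁.neg, hF₂, hG₂.neg⟩
  have hq : ∀ i, DifferentiableOn ℂ (q i) D := by
    simp only [Fin.forall_fin_succ, IsEmpty.forall_iff, and_true]
    exact ⟨hG₁.hatC hD hconj, hF₁.hatC hD hconj, hG₂.hatC hD hconj, hF₂.hatC hD hconj⟩
  have hminor : ∀ w ∈ D, ∃ i j, p i w * q j w - p j w * q i w ≠ 0 := by
    intro w hw
    by_contra! hall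
    obtain ⟨i, hi⟩ : ∃ i, p i w ≠ 0 := by
      by_contra! hzero
      have h0 : F₁ w = 0 := hzero 0
      have h1 : G₁ w = 0 := neg_eq_zero.1 (hzero 1)
      have h2 : F₂ w = 0 := hzero 2
      have h3 : G₂ w = 0 := neg_eq_zero.1 (hzero 3)
      rcases hnz _ hw with h | h
      · exact h (by rw [hsplit₁ w hw, h0, h1]; simp [toSlice])
      · exact h (by rw [hsplit₂ w hw, h2, h3]; simp [toSlice])
    have hprop : ∀ j, q j w = q i w / p i w * p j w := fun j => by
      field_simp
      linear_combination hall i j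
    obtain ⟨z, hz, hfz⟩ := exists_common_zero (ι := Fin 2) hΩ (f := ![f₁, f₂])
      (F := ![F₁, F₂]) (G := ![G₁, G₂]) (c := q i w / p i w)
      (Fin.forall_fin_two.2 ⟨hreg₁, hreg₂⟩) hI hJ hIJ
      (Fin.forall_fin_two.2 ⟨hsplit₁, hsplit₂⟩) hw
      (Fin.forall_fin_two.2 ⟨hprop 0, hprop 2⟩)
      (Fin.forall_fin_two.2 ⟨(hprop 1).trans (mul_neg _ _), (hprop 3).trans (mul_neg _ _)⟩)
    exact (hnz z hz).elim (fun h => h (hfz 0)) fun h => h (hfz 1)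
  obtain ⟨U, hUD, hU, hwU, hUconj, X, hXd, hX⟩ :=
    exists_isHoloSolution_conj_invariant hconj (fun w hw => by
      obtain ⟨i, j, hij⟩ := hminor w hw
      exact exists_isHoloSolution_of_minor_ne_zero hD hp hq hw hij) hw₀
  refine ⟨U, hU, hwU, hUD, hUconj, X 0, hatC (X 1), X 2, hatC (X 3), hXd 0,
    (hXd 1).hatC hU hUconj, hXd 2, (hXd 3).hatC hU hUconj, fun w hw => ⟨?_, ?_⟩⟩
  · have h := (hX w hw).1
    simp only [Fin.sum_univ_four, p, Matrix.cons_val, Pi.neg_apply] at h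
    simp only [hatC, Complex.conj_conj]
    linear_combination h
  · have h := congrArg (starRingEnd ℂ) (hX _ (hUconj w hw)).2
    simp only [Fin.sum_univ_four, q, Matrix.cons_val, hatC, map_add, map_mul, Complex.conj_conj,
      map_zero] at h
    simp only [hatC]
    linear_combination h
end
end

section
/- Let f(q) = Σ_{n≥0} qⁿaₙ and g(q) = Σ_{n≥0} qⁿbₙ be quaternionic power series, both converging on the ball B(0,R) for some R > 0, and let cₙ = Σ_{m=0}^{n} aₘ b_{n−m} be the coefficients of their Cauchy product. Then the series h(q) = Σ_{n≥0} qⁿcₙ converges on B(0,R), and for every q ∈ B(0,R): if f(q) ≠ 0 then h(q) = f(q) · g(f(q)⁻¹ q f(q)), and if f(q) = 0 then h(q) = 0. (This expresses that the regular product f * g coincides with the Cauchy product of the power series expansions and satisfies the pointwise transformation formula.) -/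
noncomputable section

/-- The coefficients of the Cauchy product of two quaternionic power series:
`cₙ = Σ_{m=0}^{n} aₘ b_{n−m}`. -/
def cauchyCoeff (a b : ℕ → Quaternion ℝ) (n : ℕ) : Quaternion ℝ :=
  ∑ m ∈ Finset.range (n + 1), a m * b (n - m)

/-- The terms of the Cauchy product series, as a sum over the antidiagonal of the
double family `qᵏ (qᵐ aₘ) bₖ`. -/
theorem pow_mul_cauchyCoeff (a b : ℕ → Quaternion ℝ) (q : Quaternion ℝ) (n : ℕ) :
    q ^ n * cauchyCoeff a b n =
      ∑ p ∈ Finset.HasAntidiagonal.antidiagonal n, q ^ p.2 * (q ^ p.1 * a p.1) * b p.2 := by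
  rw [cauchyCoeff, ← Finset.Nat.sum_antidiagonal_eq_sum_range_succ (fun i j => a i * b j),
    Finset.mul_sum]
  refine Finset.sum_congr rfl fun p hp => ?_
  rw [← Finset.HasAntidiagonal.mem_antidiagonal.mp hp, add_comm, pow_add]
  simp only [mul_assoc]

/-- The double family `qᵏ (qᵐ aₘ) bₖ` is summable if both power series converge at `q`. -/
theorem summable_pow_mul_mul {a b : ℕ → Quaternion ℝ} {q : Quaternion ℝ}
    (ha : Summable fun n => q ^ n * a n) (hb : Summable fun n => q ^ n * b n) :
    Summable fun p : ℕ × ℕ => q ^ p.2 * (q ^ p.1 * a p.1) * b p.2 := by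
  refine Summable.of_norm ((ha.norm.mul_of_nonneg hb.norm (fun _ => norm_nonneg _)
    (fun _ => norm_nonneg _)).congr fun p => ?_)
  simp only [norm_mul]
  ring

/-- If `f(q) = Σ qᵐaₘ` and `Σ qᵏbₖ` converge at `q`, the Cauchy product series converges at `q`
to `Σ qᵏ f(q) bₖ`. -/
theorem hasSum_pow_mul_cauchyCoeff {a b : ℕ → Quaternion ℝ} {q : Quaternion ℝ}
    (ha : Summable fun n => q ^ n * a n) (hb : Summable fun n => q ^ n * b n) :
    HasSum (fun n => q ^ n * cauchyCoeff a b n)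
      (∑' k, q ^ k * (∑' m, q ^ m * a m) * b k) := by
  have hF := summable_pow_mul_mul ha hb
  have hsum := ((Equiv.prodComm ℕ ℕ).hasSum_iff.mpr hF.hasSum).prod_fiberwise fun k =>
    (ha.hasSum.mul_left (q ^ k)).mul_right (b k)
  rw [hsum.tsum_eq]
  have hσ := (Finset.HasAntidiagonal.sigmaAntidiagonalEquivProd (A := ℕ)).hasSum_iff.mpr hF.hasSum
  have hfib := hσ.sigma fun n => hasSum_fintype _
  convert hfib using 2 with n
  rw [pow_mul_cauchyCoeff, ← Finset.sum_coe_sort]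
  rfl

/-- If `f(q) = Σ qⁿaₙ` and `g(q) = Σ qⁿbₙ` converge on `B(0,R)`, then their Cauchy
product `h(q) = Σ qⁿcₙ` converges on `B(0,R)` and equals the regular product pointwise:
`h(q) = f(q) · g(f(q)⁻¹ q f(q))` when `f(q) ≠ 0`, and `h(q) = 0` when `f(q) = 0`. -/
theorem cauchy_product_eq_regular_product
    (R : ℝ) (hR : 0 < R) (a b : ℕ → Quaternion ℝ)
    (hf : ∀ q : Quaternion ℝ, ‖q‖ < R → Summable (fun n => q ^ n * a n))
    (hg : ∀ q : Quaternion ℝ, ‖q‖ < R → Summable (fun n => q ^ n * b n)) :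
    ∀ q : Quaternion ℝ, ‖q‖ < R →
      Summable (fun n => q ^ n * cauchyCoeff a b n) ∧
      ((∑' n, q ^ n * a n) ≠ 0 →
        (∑' n, q ^ n * cauchyCoeff a b n) =
          (∑' n, q ^ n * a n) *
            (∑' n, ((∑' k, q ^ k * a k)⁻¹ * q * (∑' k, q ^ k * a k)) ^ n * b n)) ∧
      ((∑' n, q ^ n * a n) = 0 → (∑' n, q ^ n * cauchyCoeff a b n) = 0) := by
  intro q hq
  have h := hasSum_pow_mul_cauchyCoeff (hf q hq) (hg q hq)
  refine ⟨h.summable, fun hne => ?_, fun h0 => ?_⟩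
  · rw [h.tsum_eq, ← tsum_mul_left]
    refine tsum_congr fun n => ?_
    have hconj : SemiconjBy (∑' k, q ^ k * a k)
        ((∑' k, q ^ k * a k)⁻¹ * q * (∑' k, q ^ k * a k)) q := by
      rw [SemiconjBy, mul_assoc, mul_inv_cancel_left₀ hne]
    rw [← mul_assoc, (hconj.pow_right n).eq]
  · simp [h.tsum_eq, h0]
end
end

section
/- Let f(q) = Σ_{n≥0} qⁿaₙ and g(q) = Σ_{n≥0} qⁿbₙ be quaternionic power series, both converging on the ball B(0,R) for some R > 0, and let h(q) = Σ_{n≥0} qⁿcₙ with cₙ = Σ_{m=0}^{n} aₘ b_{n−m} be their Cauchy product. Then for every q ∈ B(0,R): h(q) = 0 if and only if f(q) = 0, or f(q) ≠ 0 and g(f(q)⁻¹ q f(q)) = 0. -/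
noncomputable section

/-- If `Σ qⁿaₙ` and `Σ qⁿbₙ` converge at `q`, then the Cauchy product at `q` is
`Σ qⁿ f(q) bₙ`, where `f(q) = Σ qⁿaₙ`. -/
theorem tsum_pow_mul_cauchyCoeff {a b : ℕ → Quaternion ℝ} {q : Quaternion ℝ}
    (ha : Summable fun n => q ^ n * a n) (hb : Summable fun n => q ^ n * b n) :
    ∑' n, q ^ n * cauchyCoeff a b n = ∑' n, q ^ n * (∑' k, q ^ k * a k) * b n := by
  let F : ℕ × ℕ → Quaternion ℝ := fun p => q ^ (p.1 + p.2) * (a p.1 * b p.2)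
  have hF : Summable F := by
    refine Summable.of_norm ((ha.norm.mul_of_nonneg hb.norm (fun _ => norm_nonneg _)
      (fun _ => norm_nonneg _)).congr fun p => ?_)
    simp only [F, norm_mul, norm_pow, pow_add]
    ring
  have hdiag : ∑' p, F p = ∑' n, q ^ n * cauchyCoeff a b n := by
    rw [← Finset.HasAntidiagonal.sigmaAntidiagonalEquivProd.tsum_eq F]
    refine (Summable.tsum_sigma' (fun n => (hasSum_fintype _).summable)
      (Finset.HasAntidiagonal.sigmaAntidiagonalEquivProd.summable_iff.mpr hF)).trans
      (tsum_congr fun n => ?_)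
    rw [tsum_fintype, cauchyCoeff, Finset.mul_sum,
      ← Finset.Nat.sum_antidiagonal_eq_sum_range_succ (fun i j => q ^ n * (a i * b j)),
      ← Finset.sum_coe_sort (Finset.HasAntidiagonal.antidiagonal n)]
    refine Finset.sum_congr rfl fun p _ => ?_
    simp [F, Finset.HasAntidiagonal.mem_antidiagonal.mp p.2]
  rw [← hdiag, hF.tsum_prod, ← Summable.tsum_comm (f := fun m n => F (m, n)) hF]
  refine tsum_congr fun n => ?_
  rw [mul_assoc, ← ha.tsum_mul_right, ← (ha.mul_right _).tsum_mul_left]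
  exact tsum_congr fun m => by simp only [F, ((Commute.refl q).pow_pow m n).left_comm, pow_add, mul_assoc]

/-- Where the power series of `f` and `g` converge and `f(q) ≠ 0`, the Cauchy product takes the
value `f(q) g(f(q)⁻¹ q f(q))` at `q`. -/
theorem tsum_pow_mul_cauchyCoeff_of_ne_zero {a b : ℕ → Quaternion ℝ} {q : Quaternion ℝ}
    (ha : Summable fun n => q ^ n * a n) (hb : Summable fun n => q ^ n * b n)
    (h : ∑' k, q ^ k * a k ≠ 0) :
    ∑' n, q ^ n * cauchyCoeff a b n = (∑' k, q ^ k * a k) *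
      ∑' n, ((∑' k, q ^ k * a k)⁻¹ * q * (∑' k, q ^ k * a k)) ^ n * b n := by
  rw [tsum_pow_mul_cauchyCoeff ha hb, ← tsum_mul_left]
  generalize ∑' k, q ^ k * a k = s at h
  have hs : SemiconjBy s (s⁻¹ * q * s) q := by
    simp [SemiconjBy, ← mul_assoc, mul_inv_cancel₀ h]
  exact tsum_congr fun n => by rw [← mul_assoc, (hs.pow_right n).eq]

/-- Zeros of a regular (Cauchy) product: if `f(q) = Σ qⁿaₙ` and `g(q) = Σ qⁿbₙ`
converge on `B(0,R)` and `h = f * g` is their Cauchy product, then for `q ∈ B(0,R)`,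
`h(q) = 0` iff `f(q) = 0`, or `f(q) ≠ 0` and `g(f(q)⁻¹ q f(q)) = 0`. -/
theorem zeros_of_cauchy_product
    (R : ℝ) (hR : 0 < R) (a b : ℕ → Quaternion ℝ)
    (hf : ∀ q : Quaternion ℝ, ‖q‖ < R → Summable (fun n => q ^ n * a n))
    (hg : ∀ q : Quaternion ℝ, ‖q‖ < R → Summable (fun n => q ^ n * b n)) :
    ∀ q : Quaternion ℝ, ‖q‖ < R →
      ((∑' n, q ^ n * cauchyCoeff a b n) = 0 ↔
        ((∑' n, q ^ n * a n) = 0 ∨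
          ((∑' n, q ^ n * a n) ≠ 0 ∧
            (∑' n, ((∑' k, q ^ k * a k)⁻¹ * q * (∑' k, q ^ k * a k)) ^ n * b n) = 0))) := by
  intro q hq
  by_cases h : ∑' k, q ^ k * a k = 0
  · simp [tsum_pow_mul_cauchyCoeff (hf q hq) (hg q hq), h]
  · rw [tsum_pow_mul_cauchyCoeff_of_ne_zero (hf q hq) (hg q hq) h, mul_eq_zero]
    tauto
end
end

section
/- Let f(q) = Σ_{n≥0} qⁿaₙ be a quaternionic power series converging on the ball B(0,R), R > 0. Define the regular conjugate f^c(q) = Σ_{n≥0} qⁿ conj(aₙ) and the symmetrization f^s as the Cauchy product of f and f^c, i.e. f^s(q) = Σ_{n≥0} qⁿcₙ with cₙ = Σ_{m=0}^{n} aₘ · conj(a_{n−m}). Then: (i) every coefficient cₙ is a real number, and cₙ = Σ_{m=0}^{n} conj(aₘ) · a_{n−m}, so the Cauchy products f·f^c and f^c·f coincide; (ii) consequently f^s converges on B(0,R) and is slice preserving: f^s(B(0,R) ∩ L_I) ⊆ L_I for every I ∈ 𝕊. -/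
noncomputable section

theorem cauchyCoeff_star (a b : ℕ → Quaternion ℝ) (n : ℕ) :
    star (cauchyCoeff a b n) = cauchyCoeff (fun k => star (b k)) (fun k => star (a k)) n := by
  unfold cauchyCoeff
  rw [star_sum, ← Finset.sum_range_reflect]
  refine Finset.sum_congr rfl fun m hm => ?_
  have hm' : m ≤ n := Nat.lt_succ_iff.mp (Finset.mem_range.mp hm)
  rw [star_mul, show n + 1 - 1 - m = n - m by omega, show n - (n - m) = m by omega]

theorem re_cauchyCoeff_comm (a b : ℕ → Quaternion ℝ) (n : ℕ) :
    (cauchyCoeff a b n).re = (cauchyCoeff b a n).re := by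
  have re_sum (f : ℕ → Quaternion ℝ) (s : Finset ℕ) : (∑ i ∈ s, f i).re = ∑ i ∈ s, (f i).re :=
    map_sum (QuaternionAlgebra.reₗ (-1 : ℝ) 0 (-1)) f s
  unfold cauchyCoeff
  rw [re_sum, re_sum, ← Finset.sum_range_reflect]
  refine Finset.sum_congr rfl fun m hm => ?_
  have hm' : m ≤ n := Nat.lt_succ_iff.mp (Finset.mem_range.mp hm)
  rw [show n + 1 - 1 - m = n - m by omega, show n - (n - m) = m by omega]
  simp only [Quaternion.re_mul]
  ring

theorem cauchyCoeff_conj_eq_coe (a : ℕ → Quaternion ℝ) (n : ℕ) :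
    cauchyCoeff a (fun k => star (a k)) n =
      ((cauchyCoeff a (fun k => star (a k)) n).re : Quaternion ℝ) := by
  rw [← Quaternion.star_eq_self, cauchyCoeff_star]
  simp only [star_star]

theorem cauchyCoeff_conj_comm (a : ℕ → Quaternion ℝ) (n : ℕ) :
    cauchyCoeff a (fun k => star (a k)) n = cauchyCoeff (fun k => star (a k)) a n := by
  have h := cauchyCoeff_conj_eq_coe (fun k => star (a k)) n
  simp only [star_star] at h
  rw [cauchyCoeff_conj_eq_coe, h, re_cauchyCoeff_comm]

theorem summable_pow_mul_cauchyCoeff {a b : ℕ → Quaternion ℝ} {q : Quaternion ℝ}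
    (ha : Summable fun n => q ^ n * a n) (hb : Summable fun n => q ^ n * b n) :
    Summable fun n => q ^ n * cauchyCoeff a b n := by
  have h := summable_norm_sum_mul_range_of_summable_norm ha.norm.norm hb.norm.norm
  refine Summable.of_norm_bounded h fun n => ?_
  refine le_trans ?_ (le_abs_self _)
  unfold cauchyCoeff
  rw [Finset.mul_sum]
  refine (norm_sum_le _ _).trans (Finset.sum_le_sum fun m hm => le_of_eq ?_)
  have hm' : m ≤ n := Nat.lt_succ_iff.mp (Finset.mem_range.mp hm)
  simp only [norm_mul, norm_pow]
  rw [← Nat.add_sub_cancel' hm', pow_add, Nat.add_sub_cancel_left]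
  ring

theorem sliceL_eq_span (I : Quaternion ℝ) :
    sliceL I = (Submodule.span ℝ {1, I} : Submodule ℝ (Quaternion ℝ)) := by
  ext q
  simp only [sliceL, Set.mem_ofPred_eq, SetLike.mem_coe, Submodule.mem_span_pair,
    Quaternion.coe_mul_eq_smul, ← Algebra.algebraMap_eq_smul_one, Quaternion.algebraMap_def,
    eq_comm]

theorem isClosed_sliceL (I : Quaternion ℝ) : IsClosed (sliceL I) := by
  rw [sliceL_eq_span]
  exact Submodule.closed_of_finiteDimensional _

theorem mul_mem_sliceL {I p q : Quaternion ℝ} (hI : I ∈ QSphere) (hp : p ∈ sliceL I)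
    (hq : q ∈ sliceL I) : p * q ∈ sliceL I := by
  obtain ⟨x, y, rfl⟩ := hp
  obtain ⟨u, v, rfl⟩ := hq
  have hII : I * I = -1 := by rw [← sq]; exact hI
  refine ⟨x * u - y * v, x * v + y * u, ?_⟩
  have h : (y : Quaternion ℝ) * I * (v * I) = -(y * v : ℝ) := by
    rw [mul_assoc, ← mul_assoc I, ← (Quaternion.coe_commutes v I), mul_assoc, hII]
    push_cast
    noncomm_ring
  rw [add_mul, mul_add, mul_add, h, mul_assoc _ I, ← Quaternion.coe_commutes u I]
  push_cast
  noncomm_ring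

theorem coe_mem_sliceL (I : Quaternion ℝ) (r : ℝ) : (r : Quaternion ℝ) ∈ sliceL I :=
  ⟨r, 0, by simp⟩

theorem pow_mem_sliceL {I q : Quaternion ℝ} (hI : I ∈ QSphere) (hq : q ∈ sliceL I) (n : ℕ) :
    q ^ n ∈ sliceL I := by
  induction n with
  | zero => simpa using coe_mem_sliceL I 1
  | succ n ih => rw [pow_succ]; exact mul_mem_sliceL hI ih hq

theorem tsum_mem_sliceL {I : Quaternion ℝ} {f : ℕ → Quaternion ℝ} (hf : ∀ n, f n ∈ sliceL I) :
    ∑' n, f n ∈ sliceL I := by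
  have hc := isClosed_sliceL I
  rw [sliceL_eq_span] at hf hc ⊢
  exact tsum_mem hc hf

/-- For a power series `f(q) = Σ qⁿaₙ` converging on `B(0,R)`, the coefficients
`cₙ = Σ_{m≤n} aₘ conj(a_{n−m})` of the symmetrization `f^s = f * f^c` are real and
coincide with those of `f^c * f`; consequently `f^s` converges on `B(0,R)` and is
slice preserving: `f^s(B(0,R) ∩ L_I) ⊆ L_I` for all `I ∈ 𝕊`. -/
theorem symmetrization_real_coefficients_and_slice_preserving
    (R : ℝ) (hR : 0 < R) (a : ℕ → Quaternion ℝ)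
    (hf : ∀ q : Quaternion ℝ, ‖q‖ < R → Summable (fun n => q ^ n * a n)) :
    (∀ n, (∃ r : ℝ, cauchyCoeff a (fun k => star (a k)) n = (r : Quaternion ℝ)) ∧
      cauchyCoeff a (fun k => star (a k)) n = cauchyCoeff (fun k => star (a k)) a n) ∧
    (∀ q : Quaternion ℝ, ‖q‖ < R →
      Summable (fun n => q ^ n * cauchyCoeff a (fun k => star (a k)) n)) ∧
    (∀ I ∈ QSphere, ∀ q : Quaternion ℝ, ‖q‖ < R → q ∈ sliceL I →
      (∑' n, q ^ n * cauchyCoeff a (fun k => star (a k)) n) ∈ sliceL I) := by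
  refine ⟨fun n => ⟨⟨_, cauchyCoeff_conj_eq_coe a n⟩, cauchyCoeff_conj_comm a n⟩,
    fun q hq => summable_pow_mul_cauchyCoeff (hf q hq) ?_, fun I hI q _ hqI => ?_⟩
  · refine Summable.of_norm_bounded (hf q hq).norm fun n => le_of_eq ?_
    simp only [norm_mul, norm_star]
  · refine tsum_mem_sliceL fun n => mul_mem_sliceL hI (pow_mem_sliceL hI hqI n) ?_
    rw [cauchyCoeff_conj_eq_coe]
    exact coe_mem_sliceL I _
end
end

section
/- Let h(q) = Σ_{n≥0} qⁿrₙ be a quaternionic power series with all coefficients rₙ real, converging on the ball B(0,R), R > 0. If x, y ∈ ℝ and I ∈ 𝕊 are such that x + yI ∈ B(0,R) and h(x + yI) = 0, then h(x + yI') = 0 for every I' ∈ 𝕊. In particular, for each sphere S = x + y𝕊 ⊆ B(0,R), either h vanishes identically on S or h has no zeros in S. -/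
noncomputable section

open Quaternion in
/-- The term of the series at `x + y * I` is the image of the corresponding complex term under
the embedding `ℂ → ℍ` that sends `Complex.I` to `I`. -/
theorem Complex.liftAux_term_eq (x y : ℝ) (r : ℕ → ℝ) (I : ℍ[ℝ]) (hI : I * I = -1) (n : ℕ) :
    Complex.liftAux I hI ((⟨x, y⟩ : ℂ) ^ n * (r n : ℂ))
      = ((x : ℍ[ℝ]) + (y : ℍ[ℝ]) * I) ^ n * ((r n : ℝ) : ℍ[ℝ]) := by
  simp [map_mul, map_pow, Complex.liftAux_apply, Quaternion.coe_mul_eq_smul,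
    Quaternion.algebraMap_def]

open Quaternion in
theorem hasSum_quaternion_zero_iff_complex (x y : ℝ) (r : ℕ → ℝ) (I : ℍ[ℝ]) (hI : I * I = -1) :
    HasSum (fun n => ((x : ℍ[ℝ]) + (y : ℍ[ℝ]) * I) ^ n * ((r n : ℝ) : ℍ[ℝ])) 0
      ↔ HasSum (fun n => (⟨x, y⟩ : ℂ) ^ n * (r n : ℂ)) 0 := by
  have hemb : Topology.IsClosedEmbedding (Complex.liftAux I hI).toLinearMap :=
    LinearMap.isClosedEmbedding_of_injective
      (LinearMap.ker_eq_bot.2 (Complex.liftAux I hI).toRingHom.injective)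
  rw [← hemb.isInducing.hasSum_iff (g := (Complex.liftAux I hI).toLinearMap), map_zero]
  exact iff_of_eq (congrArg (HasSum · 0)
    (funext fun n => (Complex.liftAux_term_eq x y r I hI n).symm))

/-- A quaternionic power series `h(q) = Σ qⁿrₙ` with real coefficients, converging on
`B(0,R)`, which vanishes at a point `x + yI` of a sphere `x + y𝕊 ⊆ B(0,R)` vanishes on
the whole sphere: `h(x + yI') = 0` for all `I' ∈ 𝕊`. In particular, on each such
sphere `h` either vanishes identically or has no zeros. -/
theorem real_series_vanishes_on_whole_sphere
    (R : ℝ) (hR : 0 < R) (r : ℕ → ℝ)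
    (hsum : ∀ q : Quaternion ℝ, ‖q‖ < R →
      Summable (fun n => q ^ n * ((r n : ℝ) : Quaternion ℝ))) :
    ∀ x y : ℝ, ∀ I ∈ QSphere,
      ‖(x : Quaternion ℝ) + (y : Quaternion ℝ) * I‖ < R →
      (∑' n, ((x : Quaternion ℝ) + (y : Quaternion ℝ) * I) ^ n
          * ((r n : ℝ) : Quaternion ℝ)) = 0 →
      ∀ I' ∈ QSphere,
        (∑' n, ((x : Quaternion ℝ) + (y : Quaternion ℝ) * I') ^ n
            * ((r n : ℝ) : Quaternion ℝ)) = 0 := by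
  intro x y I hI hx h0 I' hI'
  have hmem : ∀ {J : Quaternion ℝ}, J ∈ QSphere → J * J = -1 := fun hJ => (sq _).symm.trans hJ
  have h := (hsum _ hx).hasSum
  rw [h0, hasSum_quaternion_zero_iff_complex x y r I (hmem hI)] at h
  exact ((hasSum_quaternion_zero_iff_complex x y r I' (hmem hI')).2 h).tsum_eq
end
end

section
/- (Splitting Lemma) Let Ω ⊆ ℍ be a symmetric slice domain and let f : Ω → ℍ be a slice regular function. Then for every I ∈ 𝕊 and every J ∈ 𝕊 with IJ = −JI, there exist functions F, G : Ω_I → L_I, holomorphic in the sense that they have continuous partial derivatives and satisfy (∂/∂x + I ∂/∂y) F(x + yI) = 0 and (∂/∂x + I ∂/∂y) G(x + yI) = 0 on Ω_I, such that f(z) = F(z) + G(z)J for every z ∈ Ω_I. -/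
noncomputable section

/-- Imaginary units are purely imaginary. -/
lemma QSphere.re_eq_zero_s13 {I : Quaternion ℝ} (hI : I ∈ QSphere) : I.re = 0 := by
  have h : I * I = -1 := by rw [← sq]; exact hI
  have h0 := congrArg (fun q : Quaternion ℝ => q.re) h
  have h1 := congrArg (fun q : Quaternion ℝ => q.imI) h
  have h2 := congrArg (fun q : Quaternion ℝ => q.imJ) h
  have h3 := congrArg (fun q : Quaternion ℝ => q.imK) h
  simp [Quaternion.re_one, Quaternion.imI_one, Quaternion.imJ_one,
    Quaternion.imK_one] at h0 h1 h2 h3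
  by_contra hre
  have e1 : I.imI = 0 := mul_left_cancel₀ hre (by linarith)
  have e2 : I.imJ = 0 := mul_left_cancel₀ hre (by linarith)
  have e3 : I.imK = 0 := mul_left_cancel₀ hre (by linarith)
  rw [e1, e2, e3] at h0
  nlinarith [sq_nonneg I.re]

/-- The slice `L_I` contains the centralizer of `I`. -/
lemma mem_sliceL_of_commute {I q : Quaternion ℝ} (hI : I ∈ QSphere) (h : Commute q I) :
    q ∈ sliceL I := by
  have hre := QSphere.re_eq_zero_s13 hI
  have hn := congrArg (fun q : Quaternion ℝ => q.re) (show I * I = -1 by rw [← sq]; exact hI)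
  have h1 := congrArg (fun q : Quaternion ℝ => q.imI) h.eq
  have h2 := congrArg (fun q : Quaternion ℝ => q.imJ) h.eq
  have h3 := congrArg (fun q : Quaternion ℝ => q.imK) h.eq
  simp [hre, Quaternion.re_one] at hn h1 h2 h3
  refine ⟨q.re, q.imI * I.imI + q.imJ * I.imJ + q.imK * I.imK, ?_⟩
  ext
  · simp [hre]
  · simp
    linear_combination q.imI * hn + I.imJ / 2 * h3 - I.imK / 2 * h2
  · simp
    linear_combination q.imJ * hn + I.imK / 2 * h1 - I.imI / 2 * h3
  · simp
    linear_combination q.imK * hn + I.imI / 2 * h2 - I.imJ / 2 * h1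

/-- Post-composition with a real-linear map that commutes with left multiplication by `I`
preserves holomorphy on the slice `L_I`. -/
lemma HoloSlice.clm_comp {f : Quaternion ℝ → Quaternion ℝ} {I : Quaternion ℝ}
    {U : Set (Quaternion ℝ)} (hf : HoloSlice f I U) (T : Quaternion ℝ →L[ℝ] Quaternion ℝ)
    (hT : ∀ q, T (I * q) = I * T q) : HoloSlice (fun z => T (f z)) I U := by
  intro x y hxy
  obtain ⟨hc, he⟩ := hf x y hxy
  have hcomp : sliceMap (fun z => T (f z)) I = T ∘ sliceMap f I := rfl
  have hfd : fderiv ℝ (T ∘ sliceMap f I) (x, y) = T.comp (fderiv ℝ (sliceMap f I) (x, y)) :=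
    (T.hasFDerivAt.comp (x, y) (hc.differentiableAt (by norm_num)).hasFDerivAt).fderiv
  refine ⟨hcomp ▸ T.contDiff.contDiffAt.comp (x, y) hc, ?_⟩
  rw [hcomp, hfd, ContinuousLinearMap.comp_apply, ContinuousLinearMap.comp_apply, ← hT,
    ← map_add, he, map_zero]

/-- Splitting Lemma: if `f` is slice regular on a symmetric slice domain `Ω`, then for
all `I, J ∈ 𝕊` with `IJ = −JI` there are holomorphic `F, G : Ω_I → L_I` with
`f = F + G·J` on `Ω_I`. -/
theorem splitting_lemma
    (Ω : Set (Quaternion ℝ)) (hΩ : IsSymmSliceDomain Ω)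
    (f : Quaternion ℝ → Quaternion ℝ) (hf : SliceRegularOn f Ω)
    (I J : Quaternion ℝ) (hI : I ∈ QSphere) (hJ : J ∈ QSphere)
    (hIJ : I * J = -(J * I)) :
    ∃ F G : Quaternion ℝ → Quaternion ℝ,
      HoloSlice F I Ω ∧ HoloSlice G I Ω ∧
      ∀ z ∈ Ω ∩ sliceL I,
        F z ∈ sliceL I ∧ G z ∈ sliceL I ∧ f z = F z + G z * J := by
  have hII : I * I = -1 := by rw [← sq]; exact hI
  have hJJ : J * J = -1 := by rw [← sq]; exact hJ
  have hIIl (q : Quaternion ℝ) : I * (I * q) = -q := by rw [← mul_assoc, hII, neg_one_mul]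
  have hJI : J * I = -(I * J) := by rw [hIJ, neg_neg]
  -- `P` projects onto the centralizer of `I`; `q - P q` anticommutes with `I`.
  let P : Quaternion ℝ →L[ℝ] Quaternion ℝ :=
    (2⁻¹ : ℝ) • (ContinuousLinearMap.id ℝ _ - ContinuousLinearMap.mulLeftRight ℝ _ I I)
  let Q : Quaternion ℝ →L[ℝ] Quaternion ℝ :=
    (-2⁻¹ : ℝ) • (ContinuousLinearMap.mulLeftRight ℝ _ 1 J +
      ContinuousLinearMap.mulLeftRight ℝ _ I (I * J))
  have hP (q : Quaternion ℝ) : P q = (2⁻¹ : ℝ) • (q - I * q * I) := by simp [P]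
  have hQ (q : Quaternion ℝ) : Q q = (-2⁻¹ : ℝ) • (q * J + I * q * (I * J)) := by simp [Q]
  refine ⟨fun z => P (f z), fun z => Q (f z), (hf I hI).clm_comp P fun q => ?_,
    (hf I hI).clm_comp Q fun q => ?_, fun z _ => ⟨mem_sliceL_of_commute hI ?_,
      mem_sliceL_of_commute hI ?_, ?_⟩⟩
  · rw [hP, hP, mul_smul_comm]
    simp only [mul_sub, mul_assoc]
  · rw [hQ, hQ, mul_smul_comm]
    simp only [mul_add, mul_assoc]
  · simp only [hP]
    refine Commute.smul_left ?_ _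
    simp only [Commute, SemiconjBy, mul_sub, sub_mul, mul_assoc, hII, hIIl]
    simp [add_comm]
  · simp only [hQ]
    refine Commute.smul_left ?_ _
    simp only [Commute, SemiconjBy, mul_add, add_mul, mul_assoc, hJI, mul_neg, hIIl]
    simp [add_comm]
  · simp only [hP, hQ, smul_mul_assoc, add_mul, mul_assoc, hJJ, mul_neg, mul_one]
    module
end
end

section
/- (Extension Lemma) Let Ω ⊆ ℍ be a symmetric slice domain, let I ∈ 𝕊, and let f_I : Ω_I → ℍ be holomorphic, i.e. f_I has continuous partial derivatives and satisfies (∂/∂x + I ∂/∂y) f_I(x + yI) = 0 on Ω_I. Define f : Ω → ℍ by f(x + yJ) = (1/2)[f_I(x + yI) + f_I(x − yI)] + J(I/2)[f_I(x − yI) − f_I(x + yI)] for x, y ∈ ℝ and J ∈ 𝕊. Then f is well defined (the formula gives the same value for the two representations x + yJ = x + (−y)(−J), and gives f_I(x) at real points), f is slice regular on Ω, f agrees with f_I on Ω_I, and f is the unique slice regular function on Ω whose restriction to Ω_I is f_I. -/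
noncomputable section

/-! ### Imaginary units and the planes they span -/

theorem QSphere.mul_self_s14 {J : Quaternion ℝ} (hJ : J ∈ QSphere) : J * J = -1 := by
  rw [← pow_two]; exact hJ

theorem QSphere.neg_mem_s14 {J : Quaternion ℝ} (hJ : J ∈ QSphere) : -J ∈ QSphere := by
  change (-J) ^ 2 = -1
  rw [neg_sq]; exact hJ

theorem QSphere.normSq_eq_one_s14 {J : Quaternion ℝ} (hJ : J ∈ QSphere) :
    Quaternion.normSq J = 1 := by
  have h : Quaternion.normSq J ^ 2 = 1 := by
    rw [← map_pow, show J ^ 2 = -1 from hJ, Quaternion.normSq_neg, map_one]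
  have h0 : 0 ≤ Quaternion.normSq J := Quaternion.normSq_nonneg
  nlinarith

theorem QSphere.re_eq_zero_s14 {J : Quaternion ℝ} (hJ : J ∈ QSphere) : J.re = 0 := by
  rw [← Quaternion.sq_eq_neg_normSq, QSphere.normSq_eq_one_s14 hJ]
  simpa using show J ^ 2 = -1 from hJ

theorem QSphere.norm_eq_one {J : Quaternion ℝ} (hJ : J ∈ QSphere) : ‖J‖ = 1 := by
  have h := Quaternion.normSq_eq_norm_mul_self J
  rw [QSphere.normSq_eq_one_s14 hJ] at h
  nlinarith [norm_nonneg J]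

theorem QSphere.normSq_add_mul {J : Quaternion ℝ} (hJ : J ∈ QSphere) (x y : ℝ) :
    Quaternion.normSq ((x : Quaternion ℝ) + (y : Quaternion ℝ) * J) = x ^ 2 + y ^ 2 := by
  have h1 := QSphere.normSq_eq_one_s14 hJ
  have h2 := QSphere.re_eq_zero_s14 hJ
  rw [Quaternion.coe_mul_eq_smul, Quaternion.normSq_add, Quaternion.normSq_smul, h1,
    Quaternion.normSq_coe]
  simp [h2]

theorem QSphere.re_add_mul {J : Quaternion ℝ} (hJ : J ∈ QSphere) (x y : ℝ) :
    ((x : Quaternion ℝ) + (y : Quaternion ℝ) * J).re = x := by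
  simp [QSphere.re_eq_zero_s14 hJ]

theorem QSphere.im_add_mul {J : Quaternion ℝ} (hJ : J ∈ QSphere) (x y : ℝ) :
    ((x : Quaternion ℝ) + (y : Quaternion ℝ) * J).im = y • J := by
  have h := QSphere.re_eq_zero_s14 hJ
  rw [Quaternion.coe_mul_eq_smul]
  ext <;> simp [h]

theorem QSphere.inv_norm_smul_im_mem {q : Quaternion ℝ} (hq : q.im ≠ 0) :
    ‖q.im‖⁻¹ • q.im ∈ QSphere := by
  have h : ‖q.im‖ ≠ 0 := norm_ne_zero_iff.mpr hq
  change (‖q.im‖⁻¹ • q.im) ^ 2 = -1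
  rw [smul_pow, Quaternion.im_sq, Quaternion.normSq_eq_norm_mul_self, smul_neg,
    Quaternion.smul_coe, show ‖q.im‖⁻¹ ^ 2 * (‖q.im‖ * ‖q.im‖) = 1 by field_simp]
  simp

theorem exists_eq_add_mul_of_mem_QSphere {I : Quaternion ℝ} (hI : I ∈ QSphere)
    (q : Quaternion ℝ) :
    ∃ J ∈ QSphere, ∃ x y : ℝ, q = (x : Quaternion ℝ) + (y : Quaternion ℝ) * J := by
  by_cases hq : q.im = 0
  · refine ⟨I, hI, q.re, 0, ?_⟩
    conv_lhs => rw [← Quaternion.re_add_im q, hq]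
    simp
  · refine ⟨_, QSphere.inv_norm_smul_im_mem hq, q.re, ‖q.im‖, ?_⟩
    rw [Quaternion.coe_mul_eq_smul, smul_inv_smul₀ (norm_ne_zero_iff.mpr hq),
      Quaternion.re_add_im]

/-! ### Identity principle -/

/-- A solution of the Cauchy–Riemann equation on a connected open subset of the plane that
vanishes on the real axis vanishes identically. -/
theorem eqOn_zero_of_cauchyRiemann {E : Type*} [NormedAddCommGroup E] [NormedSpace ℝ E]
    [NormedSpace ℂ E] [IsScalarTower ℝ ℂ E] [CompleteSpace E] {V : Set (ℝ × ℝ)}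
    (hV : IsOpen V) (hVc : IsPreconnected V) {F : ℝ × ℝ → E}
    (hF : ∀ p ∈ V, DifferentiableAt ℝ F p)
    (hCR : ∀ p ∈ V, fderiv ℝ F p (1, 0) + Complex.I • fderiv ℝ F p (0, 1) = 0)
    {x₀ : ℝ} (hx₀ : (x₀, 0) ∈ V) (h0 : ∀ x : ℝ, (x, 0) ∈ V → F (x, 0) = 0) :
    ∀ p ∈ V, F p = 0 := by
  set e := Complex.equivRealProdCLM with he
  have hU : IsOpen (e ⁻¹' V) := hV.preimage e.continuous
  have hUc : IsPreconnected (e ⁻¹' V) :=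
    e.toHomeomorph.isPreconnected_preimage.mpr hVc
  have hdiff : DifferentiableOn ℂ (F ∘ e) (e ⁻¹' V) := by
    intro z hz
    have hd : HasFDerivAt (F ∘ e) ((fderiv ℝ F (e z)).comp (e : ℂ →L[ℝ] ℝ × ℝ)) z :=
      (hF _ hz).hasFDerivAt.comp z e.hasFDerivAt
    refine (hasFDerivAt_of_restrictScalars ℝ (f' := (ContinuousLinearMap.id ℂ ℂ).smulRight
      (fderiv ℝ F (e z) (1, 0))) hd ?_).differentiableAt.differentiableWithinAt
    have hI : fderiv ℝ F (e z) (0, 1) = Complex.I • fderiv ℝ F (e z) (1, 0) := by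
      rw [eq_neg_of_add_eq_zero_left (hCR _ hz), smul_neg, smul_smul, Complex.I_mul_I]
      simp
    ext w
    have hw : e w = w.re • ((1 : ℝ), (0 : ℝ)) + w.im • ((0 : ℝ), (1 : ℝ)) := by
      simp [he]
    simp only [ContinuousLinearMap.coe_restrictScalars', ContinuousLinearMap.smulRight_apply,
      ContinuousLinearMap.id_apply, ContinuousLinearMap.comp_apply,
      ContinuousLinearEquiv.coe_coe, hw, map_add, map_smul, hI]
    conv_lhs => rw [← Complex.re_add_im w]
    rw [add_smul, mul_smul, ← Complex.coe_algebraMap, algebraMap_smul, algebraMap_smul]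
  have hfreq : ∃ᶠ z in nhdsWithin (x₀ : ℂ) {(x₀ : ℂ)}ᶜ, (F ∘ e) z = 0 := by
    have hcont : Filter.Tendsto (fun x : ℝ => (x : ℂ)) (nhdsWithin x₀ {x₀}ᶜ)
        (nhdsWithin (x₀ : ℂ) {(x₀ : ℂ)}ᶜ) := by
      refine Complex.continuous_ofReal.continuousAt.continuousWithinAt.tendsto_nhdsWithin ?_
      intro x hx
      simpa using hx
    refine hcont.frequently (Filter.Eventually.frequently ?_)
    have : ∀ᶠ x : ℝ in nhds x₀, (x, (0 : ℝ)) ∈ V :=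
      (Continuous.prodMk_left (0 : ℝ)).continuousAt.eventually_mem (hV.mem_nhds hx₀)
    filter_upwards [nhdsWithin_le_nhds this] with x hx
    simpa [he] using h0 x hx
  have hx₀' : (x₀ : ℂ) ∈ e ⁻¹' V := by simpa [he] using hx₀
  have key := (hdiff.analyticOnNhd hU).eqOn_zero_of_preconnected_of_frequently_eq_zero
    hUc hx₀' hfreq
  intro p hp
  have := key (x := e.symm p) (by simpa using hp)
  simpa using this

/-- The complex normed space structure on `ℍ` in which `Complex.I` acts as left
multiplication by the imaginary unit `J`. -/
@[reducible]
def QSphere.normedSpace {J : Quaternion ℝ} (hJ : J ∈ QSphere) :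
    NormedSpace ℂ (Quaternion ℝ) where
  toModule := Module.compHom (Quaternion ℝ)
    (Complex.liftAux J (QSphere.mul_self_s14 hJ)).toRingHom
  norm_smul_le z q := by
    change ‖Complex.liftAux J (QSphere.mul_self_s14 hJ) z * q‖ ≤ _
    rw [norm_mul, Complex.liftAux_apply]
    refine le_of_eq (congrArg (· * ‖q‖) ?_)
    have h := QSphere.normSq_add_mul hJ z.re z.im
    rw [Quaternion.normSq_eq_norm_mul_self, ← pow_two, Quaternion.coe_mul_eq_smul] at h
    rw [← sq_eq_sq₀ (norm_nonneg _) (norm_nonneg _), Complex.sq_norm, Complex.normSq_apply]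
    exact h.trans (by ring)

theorem eqOn_zero_of_quaternionic_cauchyRiemann {J : Quaternion ℝ} (hJ : J ∈ QSphere)
    {V : Set (ℝ × ℝ)} (hV : IsOpen V) (hVc : IsPreconnected V) {F : ℝ × ℝ → Quaternion ℝ}
    (hF : ∀ p ∈ V, DifferentiableAt ℝ F p)
    (hCR : ∀ p ∈ V, fderiv ℝ F p (1, 0) + J * fderiv ℝ F p (0, 1) = 0)
    {x₀ : ℝ} (hx₀ : (x₀, 0) ∈ V) (h0 : ∀ x : ℝ, (x, 0) ∈ V → F (x, 0) = 0) :
    ∀ p ∈ V, F p = 0 := by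
  let _ := QSphere.normedSpace hJ
  have hsmul : ∀ (z : ℂ) (q : Quaternion ℝ),
      z • q = Complex.liftAux J (QSphere.mul_self_s14 hJ) z * q := fun _ _ => rfl
  have : IsScalarTower ℝ ℂ (Quaternion ℝ) := ⟨fun r z q => by
    rw [hsmul, hsmul, map_smul, smul_mul_assoc]⟩
  refine eqOn_zero_of_cauchyRiemann hV hVc hF (fun p hp => ?_) hx₀ h0
  rw [hsmul, Complex.liftAux_apply_I]
  exact hCR p hp

/-! ### Planar trace of a symmetric slice domain -/

/-- The set of planar coordinates of the points of `Ω` in the slice `L_J`. -/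
def sliceTrace (Ω : Set (Quaternion ℝ)) (J : Quaternion ℝ) : Set (ℝ × ℝ) :=
  {p | (p.1 : Quaternion ℝ) + (p.2 : Quaternion ℝ) * J ∈ Ω}

theorem isOpen_sliceTrace {Ω : Set (Quaternion ℝ)} (hΩ : IsOpen Ω) (J : Quaternion ℝ) :
    IsOpen (sliceTrace Ω J) :=
  hΩ.preimage (((Quaternion.continuous_coe).comp continuous_fst).add
    (((Quaternion.continuous_coe).comp continuous_snd).mul continuous_const))

theorem isPreconnected_sliceTrace {Ω : Set (Quaternion ℝ)} {J : Quaternion ℝ}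
    (hJ : J ∈ QSphere) (hΩ : IsPreconnected (Ω ∩ sliceL J)) :
    IsPreconnected (sliceTrace Ω J) := by
  have hcont : Continuous fun q : Quaternion ℝ => (q.re, (-(q * J)).re) :=
    Quaternion.continuous_re.prodMk
      (Quaternion.continuous_re.comp (continuous_id.mul continuous_const).neg)
  have hinv : ∀ x y : ℝ, (-(((x : Quaternion ℝ) + (y : Quaternion ℝ) * J) * J)).re = y := by
    intro x y
    rw [add_mul, mul_assoc, QSphere.mul_self_s14 hJ]
    simp [QSphere.re_eq_zero_s14 hJ]
  convert hΩ.image _ hcont.continuousOn using 1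
  ext ⟨x, y⟩
  constructor
  · intro h
    exact ⟨_, ⟨h, x, y, rfl⟩, Prod.ext (QSphere.re_add_mul hJ x y) (hinv x y)⟩
  · rintro ⟨_, ⟨h, x', y', rfl⟩, hxy⟩
    obtain ⟨h1, h2⟩ := Prod.mk.inj hxy
    obtain rfl : x' = x := (QSphere.re_add_mul hJ x' y').symm.trans h1
    obtain rfl : y' = y := (hinv x' y').symm.trans h2
    exact h

theorem SliceRegularOn.eqOn_of_eqOn_real {Ω : Set (Quaternion ℝ)} (hΩ : IsSymmSliceDomain Ω)
    {I : Quaternion ℝ} (hI : I ∈ QSphere) {f g : Quaternion ℝ → Quaternion ℝ}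
    (hf : SliceRegularOn f Ω) (hg : SliceRegularOn g Ω)
    (h : ∀ x : ℝ, (x : Quaternion ℝ) ∈ Ω → f x = g x) : Set.EqOn f g Ω := by
  obtain ⟨hopen, -, ⟨x₀, hx₀⟩, hconn, -⟩ := hΩ
  intro q hq
  obtain ⟨J, hJ, x, y, rfl⟩ := exists_eq_add_mul_of_mem_QSphere hI q
  have hdf : ∀ p ∈ sliceTrace Ω J, DifferentiableAt ℝ (sliceMap f J) p := fun p hp =>
    (hf J hJ p.1 p.2 hp).1.differentiableAt one_ne_zero
  have hdg : ∀ p ∈ sliceTrace Ω J, DifferentiableAt ℝ (sliceMap g J) p := fun p hp =>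
    (hg J hJ p.1 p.2 hp).1.differentiableAt one_ne_zero
  refine sub_eq_zero.mp (eqOn_zero_of_quaternionic_cauchyRiemann hJ
    (F := sliceMap f J - sliceMap g J) (isOpen_sliceTrace hopen J)
    (isPreconnected_sliceTrace hJ (hconn J hJ).isPreconnected)
    (fun p hp => (hdf p hp).sub (hdg p hp)) (fun p hp => ?_) (x₀ := x₀)
    (by simpa [sliceTrace] using hx₀) (fun t ht => ?_) (x, y) hq)
  · have e1 := (hf J hJ p.1 p.2 hp).2
    have e2 := (hg J hJ p.1 p.2 hp).2
    rw [fderiv_sub (hdf p hp) (hdg p hp)]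
    simp only [sub_apply, mul_sub]
    rw [sub_add_sub_comm]
    exact (congrArg₂ (· - ·) e1 e2).trans (sub_zero 0)
  · have ht' : (t : Quaternion ℝ) ∈ Ω := by simpa [sliceTrace] using ht
    simpa [sliceMap, sub_eq_zero] using h t ht'

/-! ### The representation formula -/

/-- The right-hand side of the representation formula at `x + yJ`. -/
def reprFormula (fI : Quaternion ℝ → Quaternion ℝ) (I J : Quaternion ℝ) (p : ℝ × ℝ) :
    Quaternion ℝ :=
  (2 : Quaternion ℝ)⁻¹ *
      (fI ((p.1 : Quaternion ℝ) + (p.2 : Quaternion ℝ) * I) +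
        fI ((p.1 : Quaternion ℝ) - (p.2 : Quaternion ℝ) * I)) +
    J * (I * ((2 : Quaternion ℝ)⁻¹ *
      (fI ((p.1 : Quaternion ℝ) - (p.2 : Quaternion ℝ) * I) -
        fI ((p.1 : Quaternion ℝ) + (p.2 : Quaternion ℝ) * I))))

theorem reprFormula_neg_neg (fI : Quaternion ℝ → Quaternion ℝ) (I J : Quaternion ℝ) (x y : ℝ) :
    reprFormula fI I (-J) (x, -y) = reprFormula fI I J (x, y) := by
  simp only [reprFormula, Quaternion.coe_neg, neg_mul, sub_neg_eq_add, ← sub_eq_add_neg]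
  noncomm_ring

theorem reprFormula_zero (fI : Quaternion ℝ → Quaternion ℝ) (I J K : Quaternion ℝ) (x : ℝ) :
    reprFormula fI I J (x, 0) = reprFormula fI I K (x, 0) := by
  simp [reprFormula]

theorem Quaternion.two_inv_mul (q : Quaternion ℝ) :
    (2 : Quaternion ℝ)⁻¹ * q = (2⁻¹ : ℝ) • q := by
  rw [← Quaternion.coe_mul_eq_smul, Quaternion.coe_inv]
  rfl

theorem reprFormula_self (fI : Quaternion ℝ → Quaternion ℝ) {I : Quaternion ℝ}
    (hI : I ∈ QSphere) (x y : ℝ) :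
    reprFormula fI I I (x, y) = fI ((x : Quaternion ℝ) + (y : Quaternion ℝ) * I) := by
  simp only [reprFormula]
  rw [← mul_assoc I I, QSphere.mul_self_s14 hI, Quaternion.two_inv_mul, Quaternion.two_inv_mul,
    neg_one_mul]
  module

/-- The function on `ℍ` given by the representation formula. -/
def reprExtension (fI : Quaternion ℝ → Quaternion ℝ) (I q : Quaternion ℝ) : Quaternion ℝ :=
  reprFormula fI I (‖q.im‖⁻¹ • q.im) (q.re, ‖q.im‖)

theorem reprExtension_add_mul (fI : Quaternion ℝ → Quaternion ℝ) (I : Quaternion ℝ)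
    {J : Quaternion ℝ} (hJ : J ∈ QSphere) (x y : ℝ) :
    reprExtension fI I ((x : Quaternion ℝ) + (y : Quaternion ℝ) * J) =
      reprFormula fI I J (x, y) := by
  rw [reprExtension, QSphere.re_add_mul hJ, QSphere.im_add_mul hJ, norm_smul,
    QSphere.norm_eq_one hJ, mul_one, Real.norm_eq_abs, smul_smul]
  rcases lt_trichotomy y 0 with hy | rfl | hy
  · rw [abs_of_neg hy, inv_neg, neg_mul, inv_mul_cancel₀ hy.ne, neg_one_smul,
      reprFormula_neg_neg]
  · rw [abs_zero]
    exact reprFormula_zero _ _ _ _ _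
  · rw [abs_of_pos hy, inv_mul_cancel₀ hy.ne', one_smul]

theorem HoloSlice.sliceRegularOn_reprExtension {Ω : Set (Quaternion ℝ)}
    (hΩ : IsSymmSliceDomain Ω) {I : Quaternion ℝ} (hI : I ∈ QSphere)
    {fI : Quaternion ℝ → Quaternion ℝ} (hfI : HoloSlice fI I Ω) :
    SliceRegularOn (reprExtension fI I) Ω := by
  obtain ⟨-, -, -, -, hsymm⟩ := hΩ
  intro J hJ x y hxy
  obtain ⟨hF, hFCR⟩ := hfI x y (hsymm x y J hJ hxy I hI)
  have hmem : (x : Quaternion ℝ) + ((-y : ℝ) : Quaternion ℝ) * I ∈ Ω := by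
    simpa using hsymm x y J hJ hxy (-I) (QSphere.neg_mem_s14 hI)
  obtain ⟨hF', hFCR'⟩ := hfI x (-y) hmem
  let c : ℝ × ℝ →L[ℝ] ℝ × ℝ :=
    (ContinuousLinearMap.fst ℝ ℝ ℝ).prod (-ContinuousLinearMap.snd ℝ ℝ ℝ)
  set F := sliceMap fI I with hFdef
  have hslice : sliceMap (reprExtension fI I) J =
      fun p => (2⁻¹ : ℝ) • (F p + F (c p)) + J * (I * ((2⁻¹ : ℝ) • (F (c p) - F p))) := by
    funext p
    rw [sliceMap, reprExtension_add_mul fI I hJ]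
    simp [reprFormula, hFdef, sliceMap, c, Quaternion.two_inv_mul,
      ← sub_eq_add_neg]
  have hG : ContDiffAt ℝ 1 (fun p => F (c p)) (x, y) :=
    ContDiffAt.comp (x, y) (g := F) (f := c) hF' c.contDiff.contDiffAt
  have hdF := (hF.differentiableAt one_ne_zero).hasFDerivAt
  have hdG : HasFDerivAt (fun p => F (c p)) ((fderiv ℝ F (x, -y)).comp c) (x, y) :=
    HasFDerivAt.comp (x, y) (g := F) (f := c)
      (hF'.differentiableAt one_ne_zero).hasFDerivAt c.hasFDerivAt
  have hd := ((hdF.add hdG).const_smul (2⁻¹ : ℝ)).add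
    ((((hdG.sub hdF).const_smul (2⁻¹ : ℝ)).const_mul I).const_mul J)
  rw [hslice]
  refine ⟨((hF.add hG).const_smul _).add
    (contDiffAt_const.mul (contDiffAt_const.mul ((hG.sub hF).const_smul _))), ?_⟩
  have hc1 : c (1, 0) = (1, 0) := by simp [c]
  have hc2 : c (0, 1) = -(0, 1) := by simp [c]
  have hII := QSphere.mul_self_s14 hI
  have hJJ := QSphere.mul_self_s14 hJ
  erw [hd.fderiv]
  simp only [add_apply, smul_apply,
    sub_apply, ContinuousLinearMap.comp_apply, hc1, hc2, map_neg]
  rw [eq_neg_of_add_eq_zero_left hFCR, eq_neg_of_add_eq_zero_left hFCR']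
  generalize fderiv ℝ F (x, y) (0, 1) = a
  generalize fderiv ℝ F (x, -y) (0, 1) = b
  simp only [smul_eq_mul, mul_add, mul_sub, mul_neg, mul_smul_comm, ← mul_assoc, hII, hJJ,
    smul_add, smul_sub, smul_neg, neg_mul, one_mul]
  module

/-- Extension Lemma: a holomorphic `f_I : Ω_I → ℍ` on a slice of a symmetric slice
domain `Ω` extends, via the representation formula
`f(x + yJ) = ½[f_I(x+yI) + f_I(x−yI)] + J(I/2)[f_I(x−yI) − f_I(x+yI)]`,
to a (well defined) slice regular function on `Ω` agreeing with `f_I` on `Ω_I`;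
moreover the extension is unique. -/
theorem extension_lemma
    (Ω : Set (Quaternion ℝ)) (hΩ : IsSymmSliceDomain Ω)
    (I : Quaternion ℝ) (hI : I ∈ QSphere)
    (fI : Quaternion ℝ → Quaternion ℝ) (hfI : HoloSlice fI I Ω) :
    ∃ f : Quaternion ℝ → Quaternion ℝ,
      SliceRegularOn f Ω ∧
      (∀ x y : ℝ, ∀ J ∈ QSphere, (x : Quaternion ℝ) + (y : Quaternion ℝ) * J ∈ Ω →
        f ((x : Quaternion ℝ) + (y : Quaternion ℝ) * J) =
          (2 : Quaternion ℝ)⁻¹ *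
              (fI ((x : Quaternion ℝ) + (y : Quaternion ℝ) * I) +
                fI ((x : Quaternion ℝ) - (y : Quaternion ℝ) * I)) +
            J * (I * ((2 : Quaternion ℝ)⁻¹ *
              (fI ((x : Quaternion ℝ) - (y : Quaternion ℝ) * I) -
                fI ((x : Quaternion ℝ) + (y : Quaternion ℝ) * I))))) ∧
      (∀ z ∈ Ω ∩ sliceL I, f z = fI z) ∧
      (∀ g : Quaternion ℝ → Quaternion ℝ, SliceRegularOn g Ω →
        (∀ z ∈ Ω ∩ sliceL I, g z = fI z) → ∀ q ∈ Ω, g q = f q) := by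
  have hreg := hfI.sliceRegularOn_reprExtension hΩ hI
  have hagree : ∀ z ∈ Ω ∩ sliceL I, reprExtension fI I z = fI z := by
    rintro _ ⟨-, x, y, rfl⟩
    rw [reprExtension_add_mul fI I hI, reprFormula_self fI hI]
  refine ⟨reprExtension fI I, hreg, fun x y J hJ _ => reprExtension_add_mul fI I hJ x y,
    hagree, fun g hg hgI => hg.eqOn_of_eqOn_real hΩ hI hreg fun x hx => ?_⟩
  have hx' : (x : Quaternion ℝ) ∈ Ω ∩ sliceL I := ⟨hx, x, 0, by simp⟩
  rw [hgI _ hx', hagree _ hx']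
end
end

section
/- (Structure of the zero set) Let Ω ⊆ ℍ be a symmetric slice domain and let f : Ω → ℍ be a slice regular function that does not vanish identically on Ω. Let Z_f = {q ∈ Ω : f(q) = 0}. Then for all x, y ∈ ℝ with x + y𝕊 ⊆ Ω, the intersection Z_f ∩ (x + y𝕊) is either empty, a single point, or the whole sphere x + y𝕊; moreover, there exists an open set U with x + y𝕊 ⊆ U ⊆ Ω such that Z_f ∩ U ⊆ x + y𝕊. In particular, Z_f consists of isolated points and isolated 2-spheres of the form x + y𝕊 with y ≠ 0. -/
noncomputable section

/-- The 2-sphere `x + y𝕊 = {x + yI : I ∈ 𝕊}` (a single real point when `y = 0`). -/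
def sphereAt (x y : ℝ) : Set (Quaternion ℝ) :=
  {q | ∃ I ∈ QSphere, q = (x : Quaternion ℝ) + (y : Quaternion ℝ) * I}

open Filter Topology

theorem mem_QSphere_iff {q : Quaternion ℝ} :
    q ∈ QSphere ↔ q.re = 0 ∧ q.imI ^ 2 + q.imJ ^ 2 + q.imK ^ 2 = 1 := by
  simp only [QSphere, Set.mem_ofPred_eq, Quaternion.ext_iff, pow_two, Quaternion.re_mul,
    Quaternion.imI_mul, Quaternion.imJ_mul, Quaternion.imK_mul, Quaternion.re_neg,
    Quaternion.imI_neg, Quaternion.imJ_neg, Quaternion.imK_neg, Quaternion.re_one,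
    Quaternion.imI_one, Quaternion.imJ_one, Quaternion.imK_one]
  constructor
  · rintro ⟨h1, h2, h3, h4⟩
    have hre : q.re = 0 := by
      by_contra h
      have a : q.imI = 0 := by
        have : q.re * q.imI = 0 := by linarith
        simpa [h] using this
      have b : q.imJ = 0 := by
        have : q.re * q.imJ = 0 := by linarith
        simpa [h] using this
      have c : q.imK = 0 := by
        have : q.re * q.imK = 0 := by linarith
        simpa [h] using this
      rw [a, b, c] at h1
      nlinarith [mul_self_nonneg q.re]
    refine ⟨hre, ?_⟩
    rw [hre] at h1
    linarith
  · rintro ⟨h1, h2⟩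
    rw [h1]
    refine ⟨?_, ?_, ?_, ?_⟩ <;> linarith

theorem mul_self_of_mem_QSphere {I : Quaternion ℝ} (hI : I ∈ QSphere) : I * I = -1 := by
  rw [← pow_two]
  exact hI

theorem neg_mem_QSphere {I : Quaternion ℝ} (hI : I ∈ QSphere) : -I ∈ QSphere := by
  simpa [QSphere] using hI

theorem mul_mul_self_of_mem_QSphere {I : Quaternion ℝ} (hI : I ∈ QSphere) (q : Quaternion ℝ) :
    I * (I * q) = -q := by
  rw [← mul_assoc, mul_self_of_mem_QSphere hI, neg_one_mul]

/-- The quaternion with given coordinates. -/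
def quatMk (a b c d : ℝ) : Quaternion ℝ := ⟨a, b, c, d⟩

@[simp] theorem re_quatMk (a b c d : ℝ) : (quatMk a b c d).re = a := rfl
@[simp] theorem imI_quatMk (a b c d : ℝ) : (quatMk a b c d).imI = b := rfl
@[simp] theorem imJ_quatMk (a b c d : ℝ) : (quatMk a b c d).imJ = c := rfl
@[simp] theorem imK_quatMk (a b c d : ℝ) : (quatMk a b c d).imK = d := rfl

/-- The imaginary unit `i`. -/
def unitI : Quaternion ℝ := quatMk 0 1 0 0

theorem unitI_mem_QSphere : unitI ∈ QSphere := by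
  rw [mem_QSphere_iff]
  simp [unitI]

/-- The point `x + yI` of the slice `L_I` corresponding to the complex number `x + yi`. -/
def slicePt (I : Quaternion ℝ) (z : ℂ) : Quaternion ℝ :=
  (z.re : Quaternion ℝ) + (z.im : Quaternion ℝ) * I

theorem continuous_slicePt (I : Quaternion ℝ) : Continuous (slicePt I) :=
  (Quaternion.continuous_coe.comp Complex.continuous_re).add
    ((Quaternion.continuous_coe.comp Complex.continuous_im).mul continuous_const)

theorem slicePt_ofReal (I : Quaternion ℝ) (x : ℝ) : slicePt I x = (x : Quaternion ℝ) := by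
  simp [slicePt]

/-- Every quaternion lies in the closed upper half of some slice. -/
theorem exists_slicePt_eq (q : Quaternion ℝ) :
    ∃ I ∈ QSphere, slicePt I ⟨q.re, ‖q.im‖⟩ = q := by
  by_cases h : q.im = 0
  · refine ⟨unitI, unitI_mem_QSphere, ?_⟩
    have hq := Quaternion.re_add_im q
    rw [h, add_zero] at hq
    simpa [slicePt, h] using hq
  · have hn : ‖q.im‖ ≠ 0 := norm_ne_zero_iff.mpr h
    have hsq : q.imI ^ 2 + q.imJ ^ 2 + q.imK ^ 2 = ‖q.im‖ ^ 2 := by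
      rw [pow_two ‖q.im‖, ← Quaternion.normSq_eq_norm_mul_self, Quaternion.normSq_def']
      simp
    refine ⟨‖q.im‖⁻¹ • q.im, ?_, ?_⟩
    · rw [mem_QSphere_iff]
      refine ⟨by simp, ?_⟩
      simp only [Quaternion.imI_smul, Quaternion.imJ_smul, Quaternion.imK_smul,
        Quaternion.imI_im, Quaternion.imJ_im, Quaternion.imK_im, smul_eq_mul, mul_pow]
      rw [← mul_add, ← mul_add, hsq]
      field_simp
    · rw [slicePt, Quaternion.coe_mul_eq_smul, smul_smul, mul_inv_cancel₀ hn, one_smul]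
      exact Quaternion.re_add_im q

theorem re_and_norm_im_slicePt {I : Quaternion ℝ} (hI : I ∈ QSphere) (z : ℂ) :
    (slicePt I z).re = z.re ∧ ‖(slicePt I z).im‖ = |z.im| := by
  obtain ⟨h0, h1⟩ := mem_QSphere_iff.mp hI
  refine ⟨by simp [slicePt, h0], ?_⟩
  rw [← abs_norm, ← sq_eq_sq_iff_abs_eq_abs, pow_two ‖_‖, ← Quaternion.normSq_eq_norm_mul_self,
    Quaternion.normSq_def']
  simp [slicePt, mul_pow, h0]
  linear_combination z.im ^ 2 * h1

/-- The planar domain parametrizing the slices of a symmetric set. -/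
def planarDomain (Ω : Set (Quaternion ℝ)) : Set ℂ := {z | slicePt unitI z ∈ Ω}

theorem slicePt_mem_iff {Ω : Set (Quaternion ℝ)} (hΩ : IsSymmSliceDomain Ω) {I : Quaternion ℝ}
    (hI : I ∈ QSphere) {z : ℂ} : slicePt I z ∈ Ω ↔ z ∈ planarDomain Ω :=
  ⟨fun h => hΩ.2.2.2.2 _ _ I hI h _ unitI_mem_QSphere,
    fun h => hΩ.2.2.2.2 _ _ _ unitI_mem_QSphere h I hI⟩

theorem isOpen_planarDomain {Ω : Set (Quaternion ℝ)} (hΩ : IsSymmSliceDomain Ω) :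
    IsOpen (planarDomain Ω) :=
  hΩ.1.preimage (continuous_slicePt unitI)

theorem isPreconnected_planarDomain {Ω : Set (Quaternion ℝ)} (hΩ : IsSymmSliceDomain Ω) :
    IsPreconnected (planarDomain Ω) := by
  have hc : Continuous fun q : Quaternion ℝ => (q.re : ℂ) + (q.imI : ℂ) * Complex.I :=
    (Complex.continuous_ofReal.comp Quaternion.continuous_re).add
      ((Complex.continuous_ofReal.comp Quaternion.continuous_imI).mul continuous_const)
  have h := (hΩ.2.2.2.1 unitI unitI_mem_QSphere).isPreconnected.image _ hc.continuousOn
  convert h using 1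
  have key : ∀ x y : ℝ, ((((x : Quaternion ℝ) + (y : Quaternion ℝ) * unitI).re : ℂ) +
      ((((x : Quaternion ℝ) + (y : Quaternion ℝ) * unitI).imI : ℝ) : ℂ) * Complex.I) =
      ⟨x, y⟩ := by
    intro x y
    apply Complex.ext <;> simp [unitI]
  ext z
  constructor
  · intro hz
    exact ⟨_, ⟨hz, z.re, z.im, rfl⟩, key z.re z.im⟩
  · rintro ⟨q, ⟨hq, x, y, rfl⟩, rfl⟩
    simp only [key]
    exact hq

/-- `g` is holomorphic on `D` for the complex structure on `ℍ` given by left multiplication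
by `I`. -/
def LeftHoloOn (I : Quaternion ℝ) (g : ℂ → Quaternion ℝ) (D : Set ℂ) : Prop :=
  ∀ z ∈ D, ∃ L : ℂ →L[ℝ] Quaternion ℝ, HasFDerivAt g L z ∧ L Complex.I = I * L 1

/-- `b + ic` is a holomorphic function on `D` with values in the complexification of `ℍ`. -/
def StemHoloOn (b c : ℂ → Quaternion ℝ) (D : Set ℂ) : Prop :=
  ∀ z ∈ D, ∃ B C : ℂ →L[ℝ] Quaternion ℝ, HasFDerivAt b B z ∧ HasFDerivAt c C z ∧
    B Complex.I = -C 1 ∧ C Complex.I = B 1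

theorem LeftHoloOn.stemHoloOn {I : Quaternion ℝ} (hI : I ∈ QSphere) {g : ℂ → Quaternion ℝ}
    {D : Set ℂ} (hg : LeftHoloOn I g D) : StemHoloOn g (fun z => -(I * g z)) D := by
  intro z hz
  obtain ⟨L, hL, hLI⟩ := hg z hz
  refine ⟨L, -((ContinuousLinearMap.mul ℝ (Quaternion ℝ) I).comp L), hL,
    ((ContinuousLinearMap.mul ℝ (Quaternion ℝ) I).hasFDerivAt.comp z hL).neg, ?_, ?_⟩
  · simp [hLI]
  · simp [hLI, mul_mul_self_of_mem_QSphere hI]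

/-- The complex-valued component of the stem function `b + ic` in the direction `p`. -/
def stemComponent (b c : ℂ → Quaternion ℝ) (p : Quaternion ℝ) (z : ℂ) : ℂ :=
  ((inner ℝ p (b z) : ℝ) : ℂ) + ((inner ℝ p (c z) : ℝ) : ℂ) * Complex.I

theorem StemHoloOn.differentiableOn_stemComponent {b c : ℂ → Quaternion ℝ} {D : Set ℂ}
    (h : StemHoloOn b c D) (p : Quaternion ℝ) : DifferentiableOn ℂ (stemComponent b c p) D := by
  intro z hz
  obtain ⟨B, C, hB, hC, hBC, hCB⟩ := h z hz
  have h1 := (Complex.ofRealCLM.comp (innerSL ℝ p)).hasFDerivAt.comp z hB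
  have h2 := (Complex.ofRealCLM.comp (innerSL ℝ p)).hasFDerivAt.comp z hC
  have h3 : HasFDerivAt (stemComponent b c p) _ z := h1.add (h2.mul_const Complex.I)
  refine (differentiableAt_complex_iff_differentiableAt_real.mpr
    ⟨h3.differentiableAt, ?_⟩).differentiableWithinAt
  rw [h3.fderiv]
  simp [hBC, hCB]
  ring_nf
  simp

theorem frequently_nhdsNE_ofReal {D : Set ℂ} (hD : IsOpen D) {x : ℝ} (hx : (x : ℂ) ∈ D)
    {P : ℂ → Prop} (hP : ∀ t : ℝ, (t : ℂ) ∈ D → P t) : ∃ᶠ z in 𝓝[≠] (x : ℂ), P z := by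
  have ht : Tendsto (fun t : ℝ => (t : ℂ)) (𝓝[≠] x) (𝓝[≠] (x : ℂ)) :=
    Complex.continuous_ofReal.continuousAt.continuousWithinAt.tendsto_nhdsWithin
      fun t ht => by simpa using ht
  have hev : ∀ᶠ t : ℝ in 𝓝[≠] x, (t : ℂ) ∈ D :=
    (Complex.continuous_ofReal.continuousAt.eventually (hD.mem_nhds hx)).filter_mono
      nhdsWithin_le_nhds
  exact ht.frequently (hev.mono fun t h => hP t h).frequently

/-- Identity principle on a slice. -/
theorem LeftHoloOn.eq_zero_of_real {I : Quaternion ℝ} (hI : I ∈ QSphere) {g : ℂ → Quaternion ℝ}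
    {D : Set ℂ} (hg : LeftHoloOn I g D) (hD : IsOpen D) (hDc : IsPreconnected D) {x : ℝ}
    (hx : (x : ℂ) ∈ D) (h0 : ∀ t : ℝ, (t : ℂ) ∈ D → g t = 0) : ∀ z ∈ D, g z = 0 := by
  intro z hz
  have han := ((hg.stemHoloOn hI).differentiableOn_stemComponent (g z)).analyticOnNhd hD
  have := han.eqOn_zero_of_preconnected_of_frequently_eq_zero hDc hx
    (frequently_nhdsNE_ofReal hD hx fun t ht => by simp [stemComponent, h0 t ht]) hz
  have hre := congrArg Complex.re this
  simpa [stemComponent, ← Complex.ofReal_pow] using hre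

theorem SliceRegularOn.leftHoloOn {Ω : Set (Quaternion ℝ)} (hΩ : IsSymmSliceDomain Ω)
    {f : Quaternion ℝ → Quaternion ℝ} (hf : SliceRegularOn f Ω) {I : Quaternion ℝ}
    (hI : I ∈ QSphere) : LeftHoloOn I (fun z => f (slicePt I z)) (planarDomain Ω) := by
  intro z hz
  obtain ⟨hd, heq⟩ := hf I hI z.re z.im ((slicePt_mem_iff hΩ hI).mpr hz)
  have h1 : HasFDerivAt (sliceMap f I) (fderiv ℝ (sliceMap f I) (z.re, z.im))
      (Complex.equivRealProdCLM z) := (hd.differentiableAt one_ne_zero).hasFDerivAt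
  refine ⟨_, h1.comp z Complex.equivRealProdCLM.hasFDerivAt, ?_⟩
  have := congrArg (I * ·) heq
  simp only [mul_add, mul_mul_self_of_mem_QSphere hI, mul_zero] at this
  simpa using (add_neg_eq_zero.mp this).symm

/-- The real part of the stem function of `f`. -/
def stemRe (f : Quaternion ℝ → Quaternion ℝ) (z : ℂ) : Quaternion ℝ :=
  (2⁻¹ : ℝ) • (f (slicePt unitI z) + f (slicePt (-unitI) z))

/-- The imaginary part of the stem function of `f`. -/
def stemIm (f : Quaternion ℝ → Quaternion ℝ) (z : ℂ) : Quaternion ℝ :=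
  (2⁻¹ : ℝ) • (unitI * (f (slicePt (-unitI) z) - f (slicePt unitI z)))

theorem stemRe_ofReal (f : Quaternion ℝ → Quaternion ℝ) (x : ℝ) : stemRe f x = f x := by
  rw [stemRe, slicePt_ofReal, slicePt_ofReal, ← two_smul ℝ, smul_smul]
  norm_num

theorem stemIm_ofReal (f : Quaternion ℝ → Quaternion ℝ) (x : ℝ) : stemIm f x = 0 := by
  simp [stemIm, slicePt_ofReal]

theorem SliceRegularOn.stemHoloOn {Ω : Set (Quaternion ℝ)} (hΩ : IsSymmSliceDomain Ω)
    {f : Quaternion ℝ → Quaternion ℝ} (hf : SliceRegularOn f Ω) :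
    StemHoloOn (stemRe f) (stemIm f) (planarDomain Ω) := by
  intro z hz
  obtain ⟨L, hL, hLI⟩ := hf.leftHoloOn hΩ unitI_mem_QSphere z hz
  obtain ⟨M, hM, hMI⟩ := hf.leftHoloOn hΩ (neg_mem_QSphere unitI_mem_QSphere) z hz
  refine ⟨_, _, (hL.add hM).const_smul (2⁻¹ : ℝ),
    ((ContinuousLinearMap.mul ℝ (Quaternion ℝ) unitI).hasFDerivAt.comp z
      (hM.sub hL)).const_smul (2⁻¹ : ℝ), ?_, ?_⟩
  · simp [hLI, hMI, ← smul_neg, -smul_add]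
    abel_nf
  · simp [hLI, hMI, mul_mul_self_of_mem_QSphere unitI_mem_QSphere]
    abel

/-- Representation formula. -/
theorem SliceRegularOn.apply_slicePt {Ω : Set (Quaternion ℝ)} (hΩ : IsSymmSliceDomain Ω)
    {f : Quaternion ℝ → Quaternion ℝ} (hf : SliceRegularOn f Ω) {J : Quaternion ℝ}
    (hJ : J ∈ QSphere) {z : ℂ} (hz : z ∈ planarDomain Ω) :
    f (slicePt J z) = stemRe f z + J * stemIm f z := by
  obtain ⟨x, hx⟩ := hΩ.2.2.1
  rw [← slicePt_ofReal unitI] at hx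
  rw [← sub_eq_zero]
  have hg : LeftHoloOn J (fun z => f (slicePt J z) - (stemRe f z + J * stemIm f z))
      (planarDomain Ω) := by
    intro w hw
    obtain ⟨L, hL, hLI⟩ := hf.leftHoloOn hΩ hJ w hw
    obtain ⟨B, C, hB, hC, hBC, hCB⟩ := hf.stemHoloOn hΩ w hw
    refine ⟨_, hL.sub (hB.add
      ((ContinuousLinearMap.mul ℝ (Quaternion ℝ) J).hasFDerivAt.comp w hC)), ?_⟩
    simp [hLI, hBC, hCB, mul_sub, mul_add, mul_mul_self_of_mem_QSphere hJ]
    abel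
  exact hg.eq_zero_of_real hJ (isOpen_planarDomain hΩ) (isPreconnected_planarDomain hΩ) hx
    (fun t _ => by simp [stemRe_ofReal, stemIm_ofReal, slicePt_ofReal]) z hz

/-- The normal function (symmetrization) of `f`, as a complex function. -/
def stemNorm (f : Quaternion ℝ → Quaternion ℝ) (z : ℂ) : ℂ :=
  stemComponent (stemRe f) (stemIm f) 1 z ^ 2 +
  stemComponent (stemRe f) (stemIm f) (quatMk 0 1 0 0) z ^ 2 +
  stemComponent (stemRe f) (stemIm f) (quatMk 0 0 1 0) z ^ 2 +
  stemComponent (stemRe f) (stemIm f) (quatMk 0 0 0 1) z ^ 2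

theorem stemNorm_eq (f : Quaternion ℝ → Quaternion ℝ) (z : ℂ) :
    stemNorm f z = ((‖stemRe f z‖ ^ 2 - ‖stemIm f z‖ ^ 2 : ℝ) : ℂ) +
      ((2 * inner ℝ (stemRe f z) (stemIm f z) : ℝ) : ℂ) * Complex.I := by
  simp only [pow_two ‖_‖, ← Quaternion.normSq_eq_norm_mul_self, Quaternion.normSq_def',
    stemNorm, stemComponent, Quaternion.inner_def]
  apply Complex.ext <;> simp [pow_two] <;> ring

theorem SliceRegularOn.stemNorm_eq_zero {Ω : Set (Quaternion ℝ)} (hΩ : IsSymmSliceDomain Ω)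
    {f : Quaternion ℝ → Quaternion ℝ} (hf : SliceRegularOn f Ω) {J : Quaternion ℝ}
    (hJ : J ∈ QSphere) {z : ℂ} (hz : z ∈ planarDomain Ω) (h0 : f (slicePt J z) = 0) :
    stemNorm f z = 0 := by
  rw [hf.apply_slicePt hΩ hJ hz] at h0
  have hb : stemRe f z = -(J * stemIm f z) := eq_neg_of_add_eq_zero_left h0
  obtain ⟨hJ0, hJ1⟩ := mem_QSphere_iff.mp hJ
  have hJn : ‖J‖ ^ 2 = 1 := by
    rw [pow_two, ← Quaternion.normSq_eq_norm_mul_self, Quaternion.normSq_def', hJ0]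
    linarith
  have hinner : inner ℝ (J * stemIm f z) (stemIm f z) = 0 := by
    rw [Quaternion.inner_def]
    simp [hJ0]
    ring
  rw [stemNorm_eq, hb, norm_neg, norm_mul, mul_pow, hJn, inner_neg_left, hinner]
  simp

theorem SliceRegularOn.eventually_stemNorm_ne_zero {Ω : Set (Quaternion ℝ)}
    (hΩ : IsSymmSliceDomain Ω) {f : Quaternion ℝ → Quaternion ℝ} (hf : SliceRegularOn f Ω)
    (hne : ∃ q ∈ Ω, f q ≠ 0) {z : ℂ} (hz : z ∈ planarDomain Ω) :
    ∀ᶠ w in 𝓝[≠] z, stemNorm f w ≠ 0 := by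
  have hD := isOpen_planarDomain hΩ
  have hDc := isPreconnected_planarDomain hΩ
  have hcomp := (hf.stemHoloOn hΩ).differentiableOn_stemComponent
  have han : AnalyticOnNhd ℂ (stemNorm f) (planarDomain Ω) :=
    DifferentiableOn.analyticOnNhd (((((hcomp _).pow 2).add ((hcomp _).pow 2)).add
      ((hcomp _).pow 2)).add ((hcomp _).pow 2)) hD
  by_contra hfreq
  have hzero := han.eqOn_zero_of_preconnected_of_frequently_eq_zero hDc hz (by
    rw [Filter.not_eventually] at hfreq
    exact hfreq.mono fun w hw => not_not.mp hw)
  obtain ⟨q, hq, hfq⟩ := hne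
  obtain ⟨I, hI, hIq⟩ := exists_slicePt_eq q
  obtain ⟨x, hx⟩ := hΩ.2.2.1
  rw [← slicePt_ofReal unitI] at hx
  rw [← hIq] at hq hfq
  refine hfq ((hf.leftHoloOn hΩ hI).eq_zero_of_real hI hD hDc hx (fun t ht => ?_) _
    ((slicePt_mem_iff hΩ hI).mp hq))
  have := hzero ht
  rw [stemNorm_eq, stemRe_ofReal, stemIm_ofReal] at this
  simpa [slicePt_ofReal, ← Complex.ofReal_pow] using this

theorem sphereAt_eq_of_abs_eq {x y y' : ℝ} (h : |y| = |y'|) : sphereAt x y = sphereAt x y' := by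
  rcases abs_eq_abs.mp h with rfl | rfl
  · rfl
  · ext q
    constructor <;> rintro ⟨I, hI, rfl⟩ <;> exact ⟨-I, neg_mem_QSphere hI, by simp⟩

/-- A slice regular function with two zeros on a sphere vanishes on the whole sphere. -/
theorem SliceRegularOn.eq_zero_of_two_zeros {Ω : Set (Quaternion ℝ)} (hΩ : IsSymmSliceDomain Ω)
    {f : Quaternion ℝ → Quaternion ℝ} (hf : SliceRegularOn f Ω) {J K : Quaternion ℝ}
    (hJ : J ∈ QSphere) (hK : K ∈ QSphere) {z : ℂ} (hz : z ∈ planarDomain Ω) (hJK : J ≠ K)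
    (h1 : f (slicePt J z) = 0) (h2 : f (slicePt K z) = 0) {I : Quaternion ℝ}
    (hI : I ∈ QSphere) : f (slicePt I z) = 0 := by
  rw [hf.apply_slicePt hΩ hJ hz] at h1
  rw [hf.apply_slicePt hΩ hK hz] at h2
  have hc : stemIm f z = 0 := by
    have : (J - K) * stemIm f z = 0 := by
      rw [sub_mul, sub_eq_zero]
      exact add_left_cancel (h1.trans h2.symm)
    exact (mul_eq_zero.mp this).resolve_left (sub_ne_zero.mpr hJK)
  rw [hf.apply_slicePt hΩ hI hz]
  simpa [hc] using h1

/-- Structure of the zero set: if `f` is slice regular and not identically zero on a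
symmetric slice domain `Ω`, then for each sphere `x + y𝕊 ⊆ Ω` the zero set of `f`
meets `x + y𝕊` in the empty set, a single point, or the whole sphere, and there is an
open set `U` with `x + y𝕊 ⊆ U ⊆ Ω` containing no other zeros of `f`. -/
theorem structure_of_zero_set
    (Ω : Set (Quaternion ℝ)) (hΩ : IsSymmSliceDomain Ω)
    (f : Quaternion ℝ → Quaternion ℝ) (hf : SliceRegularOn f Ω)
    (hne : ∃ q ∈ Ω, f q ≠ 0) :
    ∀ x y : ℝ, sphereAt x y ⊆ Ω →
      ({q ∈ Ω | f q = 0} ∩ sphereAt x y = ∅ ∨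
        (∃ p, {q ∈ Ω | f q = 0} ∩ sphereAt x y = {p}) ∨
        {q ∈ Ω | f q = 0} ∩ sphereAt x y = sphereAt x y) ∧
      (∃ U : Set (Quaternion ℝ), IsOpen U ∧ sphereAt x y ⊆ U ∧ U ⊆ Ω ∧
        {q ∈ Ω | f q = 0} ∩ U ⊆ sphereAt x y) := by
  intro x y hS
  have hz : (⟨x, y⟩ : ℂ) ∈ planarDomain Ω := hS ⟨unitI, unitI_mem_QSphere, rfl⟩
  have hz' : (⟨x, |y|⟩ : ℂ) ∈ planarDomain Ω := by
    rw [sphereAt_eq_of_abs_eq (abs_abs y).symm] at hS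
    exact hS ⟨unitI, unitI_mem_QSphere, rfl⟩
  constructor
  · rcases Set.eq_empty_or_nonempty ({q ∈ Ω | f q = 0} ∩ sphereAt x y) with h | ⟨p, hp⟩
    · exact Or.inl h
    refine Or.inr ?_
    by_cases hu : ∀ q ∈ {q ∈ Ω | f q = 0} ∩ sphereAt x y, q = p
    · exact Or.inl ⟨p, Set.eq_singleton_iff_unique_mem.mpr ⟨hp, hu⟩⟩
    · refine Or.inr (Set.inter_eq_right.mpr ?_)
      push Not at hu
      obtain ⟨q, ⟨⟨-, hq0⟩, J, hJ, rfl⟩, hqp⟩ := hu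
      obtain ⟨⟨-, hp0⟩, K, hK, rfl⟩ := hp
      rintro r ⟨I, hI, rfl⟩
      exact ⟨hS ⟨I, hI, rfl⟩, hf.eq_zero_of_two_zeros hΩ hJ hK hz
        (fun h => hqp (by rw [h])) hq0 hp0 hI⟩
  · obtain ⟨V, hV, hVo, hzV⟩ := eventually_nhds_iff.mp
      (eventually_nhdsWithin_iff.mp (hf.eventually_stemNorm_ne_zero hΩ hne hz'))
    have hc : Continuous fun q : Quaternion ℝ => (q.re : ℂ) + (‖q.im‖ : ℂ) * Complex.I :=
      (Complex.continuous_ofReal.comp Quaternion.continuous_re).add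
        ((Complex.continuous_ofReal.comp Quaternion.continuous_im.norm).mul continuous_const)
    refine ⟨Ω ∩ (fun q : Quaternion ℝ => (q.re : ℂ) + (‖q.im‖ : ℂ) * Complex.I) ⁻¹' V,
      hΩ.1.inter (hVo.preimage hc), ?_, Set.inter_subset_left, ?_⟩
    · intro q hq
      refine ⟨hS hq, ?_⟩
      obtain ⟨I, hI, rfl⟩ := hq
      obtain ⟨h1, h2⟩ := re_and_norm_im_slicePt hI ⟨x, y⟩
      simp only [slicePt] at h1 h2
      simpa only [Set.mem_preimage, h1, h2, ← Complex.mk_eq_add_mul_I] using hzV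
    · rintro q ⟨⟨hqΩ, hq0⟩, -, hqV⟩
      rw [Set.mem_preimage, ← Complex.mk_eq_add_mul_I] at hqV
      obtain ⟨I, hI, hIq⟩ := exists_slicePt_eq q
      rw [← hIq] at hqΩ hq0
      have hN := hf.stemNorm_eq_zero hΩ hI ((slicePt_mem_iff hΩ hI).mp hqΩ) hq0
      have heq : (⟨q.re, ‖q.im‖⟩ : ℂ) = ⟨x, |y|⟩ := by
        by_contra h
        exact hV _ hqV h hN
      rw [sphereAt_eq_of_abs_eq (abs_abs y).symm]
      exact ⟨I, hI, by rw [← hIq, heq]; rfl⟩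
end
end
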